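/- arXiv:1912.03376 — 2 statements merged into one kernel-verified Lean document; each statement's English description precedes it below -/
import Mathlib

section
/- Assume R_p < p^k for every prime p, and let ρ = ∏_p (1 − R_p·p^{−k}). For q, a ∈ ℕ define 𝒢(q,a) = Σ_{ν=1}^{q} e(aν/q) · η(q,ν). Then 𝒢 is quasi-multiplicative in the following sense: for all coprime q_1, q_2 ∈ ℕ and all a_1, a_2 ∈ ℕ with gcd(a_1, q_1) = gcd(a_2, q_2) = 1, one has ρ · 𝒢(q_1 q_2, a_1 q_2 + a_2 q_1) = 𝒢(q_1, a_1) · 𝒢(q_2, a_2). -/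
open scoped BigOperators Classical

noncomputable section

/-- `n` is `k`-free: no `k`-th power of a prime divides `n`. -/
def KFree (k n : ℕ) : Prop := ∀ p : ℕ, p.Prime → ¬ p ^ k ∣ n

/-- The density `η(q,a)` of the `k`-free `r`-tuples (with shifts `h`) in the residue class
`a mod q`. -/
def eta (k r : ℕ) (h : Fin r → ℕ) (q a : ℕ) : ℝ :=
  ∑' d : Fin r → ℕ,
    if (∀ i, 1 ≤ d i) ∧
        (∀ i j, ((Nat.gcd (d i ^ k) (d j ^ k) : ℤ) ∣ (h i : ℤ) - (h j : ℤ))) ∧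
        (∀ i, Nat.gcd q (d i ^ k) ∣ a + h i)
    then (∏ i, (ArithmeticFunction.moebius (d i) : ℝ)) /
          ((Nat.lcm q (Finset.univ.lcm fun i => d i ^ k) : ℕ) : ℝ)
    else 0

/-- The number of `n ≤ x` with `n ∈ ℛ` (i.e. all `n + h i` are `k`-free) and
`n ≡ a (mod q)`. -/
def countR (k r : ℕ) (h : Fin r → ℕ) (x : ℝ) (q a : ℕ) : ℕ :=
  ((Finset.Icc 1 ⌊x⌋₊).filter fun n => (∀ i, KFree k (n + h i)) ∧ n % q = a % q).card

/-- The error term `E_x(q,a)`. -/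
def Ex (k r : ℕ) (h : Fin r → ℕ) (x : ℝ) (q a : ℕ) : ℝ :=
  (countR k r h x q a : ℝ) - eta k r h q a * x

/-- `R_p`: the number of distinct residues of `h_1, …, h_r` modulo `p^k`. -/
def Rp (k r : ℕ) (h : Fin r → ℕ) (p : ℕ) : ℕ :=
  ((Finset.univ : Finset (Fin r)).image fun i => h i % p ^ k).card

/-- `e(x) = e^{2πix}`. -/
def eF (x : ℝ) : ℂ := Complex.exp (2 * Real.pi * Complex.I * x)

/-- `ρ = ∏_p (1 − R_p·p^{−k})`. -/
def rho (k r : ℕ) (h : Fin r → ℕ) : ℝ :=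
  ∏' p : Nat.Primes, (1 - (Rp k r h (p : ℕ) : ℝ) / (p : ℕ) ^ k)

/-- The (unnormalised) Gauss sum `𝒢(q,a) = Σ_{ν=1}^{q} e(aν/q)·η(q,ν)`. -/
def Gsum (k r : ℕ) (h : Fin r → ℕ) (q a : ℕ) : ℂ :=
  ∑ ν ∈ Finset.Icc 1 q, eF (((a * ν : ℕ) : ℝ) / (q : ℝ)) * (eta k r h q ν : ℂ)

/-- The compatibility conditions on the tuple `d` in the series defining `eta`. -/
def Admissible (k : ℕ) {r : ℕ} (h : Fin r → ℕ) (q a : ℕ) (d : Fin r → ℕ) : Prop :=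
  (∀ i j, ((Nat.gcd (d i ^ k) (d j ^ k) : ℤ) ∣ (h i : ℤ) - (h j : ℤ))) ∧
    ∀ i, Nat.gcd q (d i ^ k) ∣ a + h i

/-- The summand of `eta` at `d`. -/
def etaTerm (k : ℕ) {r : ℕ} (h : Fin r → ℕ) (q a : ℕ) (d : Fin r → ℕ) : ℝ :=
  if (∀ i, 1 ≤ d i) ∧ Admissible k h q a d
  then (∏ i, (ArithmeticFunction.moebius (d i) : ℝ)) /
        ((Nat.lcm q (Finset.univ.lcm fun i => d i ^ k) : ℕ) : ℝ)
  else 0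

/-- The tuples of natural numbers with least common multiple `n`; empty if `n = 0`. -/
def lcmTuples (r n : ℕ) : Finset (Fin r → ℕ) :=
  (Fintype.piFinset fun _ => n.divisors).filter fun d => Finset.univ.lcm d = n

/-- The sum of `∏ μ(d_i)` over the admissible tuples with least common multiple `n`. -/
def moebiusSum (k : ℕ) {r : ℕ} (h : Fin r → ℕ) (q a n : ℕ) : ℝ :=
  ∑ d ∈ lcmTuples r n,
    if Admissible k h q a d then ∏ i, (ArithmeticFunction.moebius (d i) : ℝ) else 0

/-- `q · eta` is the sum over `n` of this multiplicative function. -/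
def etaCoeff (k : ℕ) {r : ℕ} (h : Fin r → ℕ) (q a n : ℕ) : ℝ :=
  (Nat.gcd q (n ^ k) : ℝ) / (n : ℝ) ^ k * moebiusSum k h q a n

section Tuples

variable {r : ℕ}

theorem mem_lcmTuples (hr : 1 ≤ r) {n : ℕ} {d : Fin r → ℕ} :
    d ∈ lcmTuples r n ↔ n ≠ 0 ∧ Finset.univ.lcm d = n := by
  simp only [lcmTuples, Finset.mem_filter, Fintype.mem_piFinset, Nat.mem_divisors]
  constructor
  · rintro ⟨h1, h2⟩
    exact ⟨(h1 ⟨0, hr⟩).2, h2⟩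
  · rintro ⟨hn, h2⟩
    exact ⟨fun i => ⟨h2 ▸ Finset.dvd_lcm (Finset.mem_univ i), hn⟩, h2⟩

theorem dvd_of_mem_lcmTuples {n : ℕ} {d : Fin r → ℕ} (hd : d ∈ lcmTuples r n) (i : Fin r) :
    d i ∣ n :=
  (Finset.mem_filter.1 hd).2 ▸ Finset.dvd_lcm (Finset.mem_univ i)

theorem lcm_pow_eq (k : ℕ) (s : Finset (Fin r)) (d : Fin r → ℕ) :
    (s.lcm fun i => d i ^ k) = s.lcm d ^ k := by
  induction s using Finset.induction_on with
  | empty => simp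
  | insert a s _ ih =>
    rw [Finset.lcm_insert, Finset.lcm_insert, ih]
    exact (Nat.pow_lcm_pow).symm ▸ rfl

theorem prod_dvd_lcm_mul_prod {ι : Type*} [Fintype ι] [DecidableEq ι] (x : ι → ℕ) (w : ι → ι → ℕ)
    (hw : ∀ i j, i ≠ j → Nat.gcd (x i) (x j) ∣ w i j) (s : Finset ι) :
    ∏ i ∈ s, x i ∣ s.lcm x * ∏ i ∈ s, ∏ j, w i j := by
  induction s using Finset.induction_on with
  | empty => simp
  | insert a s ha ih =>
    have hgcd : ∀ t ⊆ s, Nat.gcd (x a) (∏ j ∈ t, x j) ∣ ∏ j ∈ t, w a j := by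
      intro t
      induction t using Finset.induction_on with
      | empty => simp
      | insert b t hb iht =>
        intro hts
        rw [Finset.prod_insert hb, Finset.prod_insert hb]
        refine (Nat.gcd_mul_right_dvd_mul_gcd _ _ _).trans (mul_dvd_mul (hw a b ?_) (iht ?_))
        · rintro rfl
          exact ha (hts (Finset.mem_insert_self _ _))
        · exact (Finset.subset_insert _ _).trans hts
    have hlcm : Nat.gcd (x a) (s.lcm x) ∣ ∏ j, w a j :=
      ((Nat.gcd_dvd_gcd_of_dvd_right _
        (Finset.lcm_dvd fun b hb => Finset.dvd_prod_of_mem x hb)).trans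
        (hgcd s subset_rfl)).trans (Finset.prod_dvd_prod_of_subset _ _ _ (Finset.subset_univ _))
    rw [Finset.prod_insert ha, Finset.prod_insert ha, Finset.lcm_insert]
    have hmul : GCDMonoid.lcm (x a) (s.lcm x) * Nat.gcd (x a) (s.lcm x) = x a * s.lcm x := by
      rw [mul_comm]; exact Nat.gcd_mul_lcm _ _
    calc x a * ∏ i ∈ s, x i ∣ x a * (s.lcm x * ∏ i ∈ s, ∏ j, w i j) := mul_dvd_mul_left _ ih
      _ = GCDMonoid.lcm (x a) (s.lcm x) * (Nat.gcd (x a) (s.lcm x) * ∏ i ∈ s, ∏ j, w i j) := by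
        rw [← mul_assoc, ← hmul, mul_assoc]
      _ ∣ _ := mul_dvd_mul_left _ (mul_dvd_mul_right hlcm _)

theorem lcm_mul_of_coprime {m n : ℕ} (hmn : m.Coprime n) {d e : Fin r → ℕ}
    (hd : ∀ i, d i ∣ m) (he : ∀ i, e i ∣ n) :
    (Finset.univ.lcm fun i => d i * e i) = Finset.univ.lcm d * Finset.univ.lcm e := by
  apply Nat.dvd_antisymm
  · exact Finset.lcm_dvd fun i hi => mul_dvd_mul (Finset.dvd_lcm hi) (Finset.dvd_lcm hi)
  · refine Nat.Coprime.mul_dvd_of_dvd_of_dvd ?_ ?_ ?_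
    · exact Nat.Coprime.of_dvd (Finset.lcm_dvd fun i _ => hd i)
        (Finset.lcm_dvd fun i _ => he i) hmn
    · exact Finset.lcm_dvd fun i hi => (Dvd.intro _ rfl).trans
        (Finset.dvd_lcm (f := fun i => d i * e i) hi)
    · exact Finset.lcm_dvd fun i hi => (Dvd.intro_left _ rfl).trans
        (Finset.dvd_lcm (f := fun i => d i * e i) hi)

theorem summable_prod_pi {g : ℕ → ℝ} (hg : Summable g) (hg0 : ∀ n, 0 ≤ g n) :
    Summable fun d : Fin r → ℕ => ∏ i, g (d i) := by
  refine summable_of_sum_le (c := (∑' n, g n) ^ r)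
    (fun d => Finset.prod_nonneg fun i _ => hg0 _) fun u => ?_
  calc ∑ d ∈ u, ∏ i, g (d i)
      ≤ ∑ d ∈ Fintype.piFinset fun i => u.image fun d => d i, ∏ i, g (d i) := by
        refine Finset.sum_le_sum_of_subset_of_nonneg (fun d hd => ?_)
          fun d _ _ => Finset.prod_nonneg fun i _ => hg0 _
        exact Fintype.mem_piFinset.2 fun i => Finset.mem_image_of_mem _ hd
    _ = ∏ i : Fin r, ∑ n ∈ u.image fun d => d i, g n := (Finset.prod_univ_sum _ _).symm
    _ ≤ ∏ _i : Fin r, ∑' n, g n :=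
        Finset.prod_le_prod (fun i _ => Finset.sum_nonneg fun n _ => hg0 n)
          fun i _ => hg.sum_le_tsum _ fun n _ => hg0 n
    _ = _ := by simp

end Tuples

section Series

variable {k r : ℕ} {h : Fin r → ℕ}

theorem eta_eq_tsum_etaTerm (q a : ℕ) : eta k r h q a = ∑' d, etaTerm k h q a d := by
  refine tsum_congr fun d => ?_
  simp only [etaTerm, Admissible]
  congr

theorem summable_norm_etaTerm (hk : 2 ≤ k) (hh : Function.Injective h) {q : ℕ} (hq : 1 ≤ q)
    (a : ℕ) : Summable fun d => ‖etaTerm k h q a d‖ := by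
  set w : Fin r → Fin r → ℕ := fun i j => if i = j then 1 else ((h i : ℤ) - h j).natAbs with hw
  set W : ℕ := ∏ i, ∏ j, w i j
  have hW : W ≠ 0 := by
    refine Finset.prod_ne_zero_iff.2 fun i _ => Finset.prod_ne_zero_iff.2 fun j _ => ?_
    by_cases hij : i = j
    · simp [hw, hij]
    · have := hh.ne hij
      simp only [hw, hij, if_false]
      omega
  have hs : Summable fun n : ℕ => 1 / (n : ℝ) ^ k := Real.summable_one_div_nat_pow.2 (by omega)
  refine Summable.of_nonneg_of_le (fun _ => norm_nonneg _) (fun d => ?_)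
    ((summable_prod_pi (r := r) hs fun n => by positivity).mul_left (W : ℝ))
  rw [etaTerm]
  split_ifs with hd
  swap
  · rw [norm_zero]; positivity
  obtain ⟨hd1, hd2, -⟩ := hd
  have hdvd := prod_dvd_lcm_mul_prod (fun i => d i ^ k) w (fun i j hij => by
    simp only [hw, hij, if_false]
    exact Int.natCast_dvd.1 (hd2 i j)) Finset.univ
  set D := Finset.univ.lcm fun i => d i ^ k
  have hD : D ≠ 0 := by
    intro h0
    obtain ⟨i, -, hi⟩ := Finset.lcm_eq_zero_iff.1 h0
    exact pow_ne_zero k (Nat.one_le_iff_ne_zero.1 (hd1 i)) hi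
  have hlcm : Nat.lcm q D ≠ 0 := Nat.lcm_ne_zero (by omega) hD
  have hle : ∏ i, d i ^ k ≤ Nat.lcm q D * W :=
    Nat.le_of_dvd (Nat.pos_of_ne_zero (mul_ne_zero hlcm hW))
      (hdvd.trans (mul_dvd_mul_right (Nat.dvd_lcm_right _ _) _))
  have hle' : (∏ i, (d i : ℝ) ^ k) ≤ (Nat.lcm q D : ℝ) * W := by exact_mod_cast hle
  have hmu : ‖∏ i, (ArithmeticFunction.moebius (d i) : ℝ)‖ ≤ 1 := by
    rw [norm_prod]
    refine Finset.prod_le_one (fun _ _ => norm_nonneg _) fun i _ => ?_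
    rw [Real.norm_eq_abs]
    exact_mod_cast ArithmeticFunction.abs_moebius_le_one
  have hpos : 0 < ∏ i, (d i : ℝ) ^ k :=
    Finset.prod_pos fun i _ => pow_pos (by exact_mod_cast hd1 i) _
  have hlpos : (0 : ℝ) < Nat.lcm q D := by exact_mod_cast Nat.pos_of_ne_zero hlcm
  rw [norm_div, Finset.prod_div_distrib, Finset.prod_const_one, mul_one_div, Real.norm_natCast,
    div_le_div_iff₀ hlpos hpos]
  calc _ ≤ 1 * ∏ i, (d i : ℝ) ^ k := mul_le_mul_of_nonneg_right hmu hpos.le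
    _ ≤ _ := by linarith

theorem tsum_fiber_etaTerm (hr : 1 ≤ r) {q : ℕ} (hq : 1 ≤ q) (a n : ℕ) :
    ∑' d : (fun d : Fin r → ℕ => Finset.univ.lcm d) ⁻¹' {n}, etaTerm k h q a d =
      etaCoeff k h q a n / q := by
  rw [tsum_subtype ((fun d : Fin r → ℕ => Finset.univ.lcm d) ⁻¹' {n}) (etaTerm k h q a),
    tsum_eq_sum (s := lcmTuples r n), etaCoeff, moebiusSum, Finset.mul_sum, Finset.sum_div]
  · refine Finset.sum_congr rfl fun d hd => ?_
    obtain ⟨hn, hdn⟩ := (mem_lcmTuples hr).1 hd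
    have hpos : ∀ i, 1 ≤ d i := fun i =>
      Nat.pos_of_ne_zero (ne_zero_of_dvd_ne_zero hn (dvd_of_mem_lcmTuples hd i))
    have hmul : (Nat.gcd q (n ^ k) : ℝ) * Nat.lcm q (n ^ k) = q * (n : ℝ) ^ k := by
      exact_mod_cast Nat.gcd_mul_lcm q (n ^ k)
    have hl : (Nat.lcm q (n ^ k) : ℝ) ≠ 0 := by
      exact_mod_cast Nat.lcm_ne_zero (by omega) (pow_ne_zero k hn)
    have hn' : (n : ℝ) ≠ 0 := by exact_mod_cast hn
    have hq' : (q : ℝ) ≠ 0 := by exact_mod_cast (by omega : q ≠ 0)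
    rw [Set.indicator_of_mem (by simpa using hdn), etaTerm, lcm_pow_eq, hdn]
    by_cases hadm : Admissible k h q a d
    · rw [if_pos ⟨hpos, hadm⟩, if_pos hadm]
      field_simp
      linear_combination (-∏ i, (ArithmeticFunction.moebius (d i) : ℝ)) * hmul
    · rw [if_neg fun h => hadm h.2, if_neg hadm, mul_zero, zero_div]
  · intro d hd
    rw [Set.indicator_apply_eq_zero]
    intro hdn
    have hn : n = 0 := by
      by_contra hn
      exact hd ((mem_lcmTuples hr).2 ⟨hn, hdn⟩)
    subst hn
    obtain ⟨i, -, hi⟩ := Finset.lcm_eq_zero_iff.1 (show Finset.univ.lcm d = 0 from hdn)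
    rw [etaTerm, if_neg]
    rintro ⟨hpos, -⟩
    have := hpos i
    simp_all

theorem hasSum_etaCoeff (hk : 2 ≤ k) (hr : 1 ≤ r) (hh : Function.Injective h) {q : ℕ}
    (hq : 1 ≤ q) (a : ℕ) : HasSum (etaCoeff k h q a) (q * eta k r h q a) := by
  have hq' : (q : ℝ) ≠ 0 := by exact_mod_cast (by omega : q ≠ 0)
  have hs := ((summable_norm_etaTerm hk hh hq a).of_norm.hasSum.tsum_fiberwise
    fun d : Fin r → ℕ => Finset.univ.lcm d).mul_left (q : ℝ)
  simp only [tsum_fiber_etaTerm hr hq, mul_div_cancel₀ _ hq'] at hs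
  rwa [eta_eq_tsum_etaTerm]

theorem summable_norm_etaCoeff (hk : 2 ≤ k) (hr : 1 ≤ r) (hh : Function.Injective h) {q : ℕ}
    (hq : 1 ≤ q) (a : ℕ) : Summable fun n => ‖etaCoeff k h q a n‖ :=
  (hasSum_etaCoeff hk hr hh hq a).summable.norm

theorem admissible_mul_iff {m n : ℕ} (hmn : m.Coprime n) {q a : ℕ} {d e : Fin r → ℕ}
    (hd : ∀ i, d i ∣ m) (he : ∀ i, e i ∣ n) :
    Admissible k h q a (fun i => d i * e i) ↔ Admissible k h q a d ∧ Admissible k h q a e := by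
  have hc : ∀ i j, Nat.Coprime (d i ^ k) (e j ^ k) := fun i j =>
    (Nat.Coprime.of_dvd (hd i) (he j) hmn).pow _ _
  have hdvd : ∀ {x y z : ℕ}, x.Coprime y → (x * y ∣ z ↔ x ∣ z ∧ y ∣ z) := fun hxy =>
    ⟨fun H => ⟨(Dvd.intro _ rfl).trans H, (Dvd.intro_left _ rfl).trans H⟩,
      fun H => hxy.mul_dvd_of_dvd_of_dvd H.1 H.2⟩
  have h1 : ∀ i j, Nat.gcd ((d i * e i) ^ k) ((d j * e j) ^ k) =
      Nat.gcd (d i ^ k) (d j ^ k) * Nat.gcd (e i ^ k) (e j ^ k) := fun i j => by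
    rw [mul_pow, mul_pow, (hc j j).gcd_mul, (hc j i).symm.gcd_mul_right_cancel,
      (hc i j).gcd_mul_left_cancel]
  have h2 : ∀ i, Nat.gcd q ((d i * e i) ^ k) = Nat.gcd q (d i ^ k) * Nat.gcd q (e i ^ k) :=
    fun i => by rw [mul_pow, (hc i i).gcd_mul]
  have h3 : ∀ i j, (Nat.gcd (d i ^ k) (d j ^ k)).Coprime (Nat.gcd (e i ^ k) (e j ^ k)) :=
    fun i j => Nat.Coprime.of_dvd (Nat.gcd_dvd_left _ _) (Nat.gcd_dvd_left _ _) (hc i i)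
  have h4 : ∀ i, (Nat.gcd q (d i ^ k)).Coprime (Nat.gcd q (e i ^ k)) :=
    fun i => Nat.Coprime.of_dvd (Nat.gcd_dvd_right _ _) (Nat.gcd_dvd_right _ _) (hc i i)
  simp only [Admissible, Int.natCast_dvd, h1, h2, hdvd (h3 _ _), hdvd (h4 _), forall_and]
  tauto

theorem moebiusSum_zero (hr : 1 ≤ r) (q a : ℕ) : moebiusSum k h q a 0 = 0 :=
  Finset.sum_eq_zero fun _ hd => absurd rfl ((mem_lcmTuples hr).1 hd).1

theorem moebiusSum_mul_of_coprime (hr : 1 ≤ r) (q a : ℕ) {m n : ℕ} (hmn : m.Coprime n) :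
    moebiusSum k h q a (m * n) = moebiusSum k h q a m * moebiusSum k h q a n := by
  rcases eq_or_ne m 0 with rfl | hm
  · rw [zero_mul, moebiusSum_zero hr, zero_mul]
  rcases eq_or_ne n 0 with rfl | hn
  · rw [mul_zero, moebiusSum_zero hr, mul_zero]
  symm
  simp only [moebiusSum]
  rw [Finset.sum_mul_sum, ← Finset.sum_product']
  have hsplit : ∀ d ∈ lcmTuples r (m * n), ∀ i, Nat.gcd (d i) m * Nat.gcd (d i) n = d i :=
    fun d hd i => by
      rw [← hmn.gcd_mul, Nat.gcd_eq_left (dvd_of_mem_lcmTuples hd i)]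
  refine Finset.sum_nbij' (fun x i => x.1 i * x.2 i)
    (fun d => (fun i => Nat.gcd (d i) m, fun i => Nat.gcd (d i) n)) ?_ ?_ ?_ ?_ ?_
  · intro x hx
    obtain ⟨h1, h2⟩ := Finset.mem_product.1 hx
    rw [mem_lcmTuples hr, lcm_mul_of_coprime hmn (dvd_of_mem_lcmTuples h1)
      (dvd_of_mem_lcmTuples h2), ((mem_lcmTuples hr).1 h1).2, ((mem_lcmTuples hr).1 h2).2]
    exact ⟨mul_ne_zero hm hn, rfl⟩
  · intro d hd
    have hlcm := lcm_mul_of_coprime hmn (d := fun i => Nat.gcd (d i) m)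
      (e := fun i => Nat.gcd (d i) n) (fun i => Nat.gcd_dvd_right _ _)
      (fun i => Nat.gcd_dvd_right _ _)
    simp only [hsplit d hd] at hlcm
    rw [((mem_lcmTuples hr).1 hd).2] at hlcm
    set A := Finset.univ.lcm fun i => Nat.gcd (d i) m with hA
    set B := Finset.univ.lcm fun i => Nat.gcd (d i) n with hB
    have hAm : A ≤ m := Nat.le_of_dvd (Nat.pos_of_ne_zero hm)
      (Finset.lcm_dvd fun i _ => Nat.gcd_dvd_right _ _)
    have hBn : B ≤ n := Nat.le_of_dvd (Nat.pos_of_ne_zero hn)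
      (Finset.lcm_dvd fun i _ => Nat.gcd_dvd_right _ _)
    have hpos : 0 < m * n := Nat.pos_of_ne_zero (mul_ne_zero hm hn)
    rw [Finset.mem_product, mem_lcmTuples hr, mem_lcmTuples hr]
    refine ⟨⟨hm, ?_⟩, hn, ?_⟩
    · change A = m
      by_contra hne
      nlinarith [Nat.pos_of_ne_zero hn, Nat.lt_of_le_of_ne hAm hne]
    · change B = n
      by_contra hne
      nlinarith [Nat.pos_of_ne_zero hm, Nat.lt_of_le_of_ne hBn hne]
  · intro x hx
    obtain ⟨h1, h2⟩ := Finset.mem_product.1 hx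
    have hc1 : ∀ i, Nat.Coprime (x.2 i) m := fun i =>
      Nat.Coprime.of_dvd_left (dvd_of_mem_lcmTuples h2 i) hmn.symm
    have hc2 : ∀ i, Nat.Coprime (x.1 i) n := fun i =>
      Nat.Coprime.of_dvd_left (dvd_of_mem_lcmTuples h1 i) hmn
    refine Prod.ext (funext fun i => ?_) (funext fun i => ?_)
    · change Nat.gcd (x.1 i * x.2 i) m = x.1 i
      rw [(hc1 i).gcd_mul_right_cancel, Nat.gcd_eq_left (dvd_of_mem_lcmTuples h1 i)]
    · change Nat.gcd (x.1 i * x.2 i) n = x.2 i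
      rw [(hc2 i).gcd_mul_left_cancel, Nat.gcd_eq_left (dvd_of_mem_lcmTuples h2 i)]
  · intro d hd
    exact funext (hsplit d hd)
  · intro x hx
    obtain ⟨h1, h2⟩ := Finset.mem_product.1 hx
    have hd1 := dvd_of_mem_lcmTuples h1
    have hd2 := dvd_of_mem_lcmTuples h2
    simp only [admissible_mul_iff hmn hd1 hd2]
    have hmu : ∀ i, (ArithmeticFunction.moebius (x.1 i * x.2 i) : ℝ) =
        ArithmeticFunction.moebius (x.1 i) * ArithmeticFunction.moebius (x.2 i) := fun i => by
      rw [ArithmeticFunction.isMultiplicative_moebius.map_mul_of_coprime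
        (Nat.Coprime.of_dvd (hd1 i) (hd2 i) hmn), Int.cast_mul]
    simp only [hmu, Finset.prod_mul_distrib]
    by_cases ha : Admissible k h q a x.1 <;> by_cases hb : Admissible k h q a x.2 <;> simp [ha, hb]

theorem etaCoeff_mul_of_coprime (hr : 1 ≤ r) (q a : ℕ) {m n : ℕ} (hmn : m.Coprime n) :
    etaCoeff k h q a (m * n) = etaCoeff k h q a m * etaCoeff k h q a n := by
  simp only [etaCoeff]
  rw [moebiusSum_mul_of_coprime hr q a hmn, mul_pow, (hmn.pow k k).gcd_mul]
  push_cast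
  rw [mul_pow, mul_div_mul_comm]
  ring

theorem etaCoeff_one (hr : 1 ≤ r) (q a : ℕ) : etaCoeff k h q a 1 = 1 := by
  have hset : lcmTuples r 1 = {fun _ => 1} := by
    ext d
    rw [mem_lcmTuples hr, Finset.mem_singleton]
    constructor
    · rintro ⟨-, hd⟩
      exact funext fun i => Nat.dvd_one.1 (hd ▸ Finset.dvd_lcm (Finset.mem_univ i))
    · rintro rfl
      exact ⟨one_ne_zero, Nat.dvd_one.1 (Finset.lcm_dvd fun _ _ => dvd_rfl)⟩
  have hadm : Admissible k h q a fun _ => 1 := by simp [Admissible]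
  rw [etaCoeff, moebiusSum, hset, Finset.sum_singleton, if_pos hadm]
  simp

theorem etaCoeff_prime_pow_eq_zero (hr : 1 ≤ r) (q a : ℕ) {p e : ℕ} (hp : p.Prime)
    (he : 2 ≤ e) : etaCoeff k h q a (p ^ e) = 0 := by
  rw [etaCoeff, moebiusSum, Finset.sum_eq_zero, mul_zero]
  intro d hd
  rw [ite_eq_right_iff]
  intro _
  by_contra hne
  have hdp : ∀ i, d i ∣ p := fun i => by
    have hi : ArithmeticFunction.moebius (d i) ≠ 0 := by
      have := Finset.prod_ne_zero_iff.1 hne i (Finset.mem_univ i)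
      exact_mod_cast this
    have hsq := ArithmeticFunction.moebius_ne_zero_iff_squarefree.1 hi
    exact (hsq.dvd_pow_iff_dvd (by omega)).1
      (dvd_of_mem_lcmTuples hd i)
  have hdvd : p ^ e ∣ p ^ 1 := by
    rw [pow_one]
    exact ((mem_lcmTuples hr).1 hd).2 ▸ Finset.lcm_dvd fun i _ => hdp i
  have := (Nat.pow_dvd_pow_iff_le_right hp.one_lt).1 hdvd
  omega

theorem hasProd_eta (hk : 2 ≤ k) (hr : 1 ≤ r) (hh : Function.Injective h) {q : ℕ}
    (hq : 1 ≤ q) (a : ℕ) :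
    HasProd (fun p : Nat.Primes => 1 + etaCoeff k h q a p) (q * eta k r h q a) := by
  have hprod := EulerProduct.eulerProduct_hasProd (etaCoeff_one hr q a)
    (fun hmn => etaCoeff_mul_of_coprime (k := k) (h := h) hr q a hmn)
    (summable_norm_etaCoeff hk hr hh hq a) (by rw [etaCoeff, moebiusSum_zero hr, mul_zero])
  rw [(hasSum_etaCoeff hk hr hh hq a).tsum_eq] at hprod
  have hlocal : ∀ p : Nat.Primes, ∑' e, etaCoeff k h q a ((p : ℕ) ^ e) = 1 + etaCoeff k h q a p :=
    fun p => by
      rw [tsum_eq_sum (s := Finset.range 2) fun e he => etaCoeff_prime_pow_eq_zero hr q a p.2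
        (not_lt.1 fun hlt => he (Finset.mem_range.2 hlt))]
      simp [Finset.sum_range_succ, etaCoeff_one hr]
  simpa only [hlocal] using hprod

theorem etaCoeff_congr {q q' a a' n : ℕ}
    (hg : ∀ d, d ∣ n → Nat.gcd q (d ^ k) = Nat.gcd q' (d ^ k))
    (ha : ∀ d i, d ∣ n → (Nat.gcd q (d ^ k) ∣ a + h i ↔ Nat.gcd q (d ^ k) ∣ a' + h i)) :
    etaCoeff k h q a n = etaCoeff k h q' a' n := by
  rw [etaCoeff, etaCoeff, hg n dvd_rfl, moebiusSum, moebiusSum]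
  congr 1
  refine Finset.sum_congr rfl fun d hd => ?_
  have hadm : Admissible k h q a d ↔ Admissible k h q' a' d := by
    refine and_congr_right fun _ => forall_congr' fun i => ?_
    rw [ha _ i (dvd_of_mem_lcmTuples hd i), hg _ (dvd_of_mem_lcmTuples hd i)]
  simp only [hadm]

theorem etaCoeff_mul_left_of_coprime {q₁ q₂ n : ℕ} (hq : q₁.Coprime n) (a : ℕ) :
    etaCoeff k h (q₁ * q₂) a n = etaCoeff k h q₂ a n :=
  etaCoeff_congr (fun _ hd => ((hq.coprime_dvd_right hd).pow_right k).gcd_mul_left_cancel _)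
    fun _ _ _ => Iff.rfl

theorem etaCoeff_of_coprime {q n : ℕ} (hq : q.Coprime n) (a b : ℕ) :
    etaCoeff k h q a n = etaCoeff k h 1 b n := by
  have hg : ∀ d, d ∣ n → Nat.gcd q (d ^ k) = 1 := fun _ hd =>
    (hq.coprime_dvd_right hd).pow_right k
  exact etaCoeff_congr (fun d hd => by rw [hg d hd, Nat.gcd_one_left])
    fun d i hd => by simp [hg d hd]

theorem eta_one_mul_eta_mul (hk : 2 ≤ k) (hr : 1 ≤ r) (hh : Function.Injective h) {q₁ q₂ : ℕ}
    (hq₁ : 1 ≤ q₁) (hq₂ : 1 ≤ q₂) (hq : q₁.Coprime q₂) (a : ℕ) :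
    eta k r h 1 0 * eta k r h (q₁ * q₂) a = eta k r h q₁ a * eta k r h q₂ a := by
  have hl := (hasProd_eta hk hr hh le_rfl 0).mul
    (hasProd_eta hk hr hh (one_le_mul hq₁ hq₂) a)
  have hrt := (hasProd_eta hk hr hh hq₁ a).mul (hasProd_eta hk hr hh hq₂ a)
  have hfun : ∀ p : Nat.Primes, (1 + etaCoeff k h 1 0 p) * (1 + etaCoeff k h (q₁ * q₂) a p) =
      (1 + etaCoeff k h q₁ a p) * (1 + etaCoeff k h q₂ a p) := fun p => by
    by_cases hp : (p : ℕ) ∣ q₁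
    · have hc : q₂.Coprime p := (hq.coprime_dvd_left hp).symm
      rw [mul_comm q₁, etaCoeff_mul_left_of_coprime hc, etaCoeff_of_coprime hc a 0, mul_comm]
    · have hc : q₁.Coprime p := ((Nat.Prime.coprime_iff_not_dvd p.2).2 hp).symm
      rw [etaCoeff_mul_left_of_coprime hc, etaCoeff_of_coprime hc a 0]
  simp only [hfun] at hl
  have heq := hl.unique hrt
  have h1 : (q₁ : ℝ) ≠ 0 := by exact_mod_cast (by omega : q₁ ≠ 0)
  have h2 : (q₂ : ℝ) ≠ 0 := by exact_mod_cast (by omega : q₂ ≠ 0)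
  push_cast at heq
  refine mul_left_cancel₀ (mul_ne_zero h1 h2) ?_
  linear_combination heq

theorem eta_congr {q a a' : ℕ} (ha : a ≡ a' [MOD q]) : eta k r h q a = eta k r h q a' := by
  refine tsum_congr fun d => ?_
  have hiff : ∀ i, Nat.gcd q (d i ^ k) ∣ a + h i ↔ Nat.gcd q (d i ^ k) ∣ a' + h i := fun i =>
    ((ha.of_dvd (Nat.gcd_dvd_left _ _)).add_right _).dvd_iff dvd_rfl
  simp only [hiff]

theorem mem_lcmTuples_prime (hr : 1 ≤ r) {p : ℕ} (hp : p.Prime) {d : Fin r → ℕ} :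
    d ∈ lcmTuples r p ↔ (∀ i, d i = 1 ∨ d i = p) ∧ ∃ i, d i = p := by
  rw [mem_lcmTuples hr]
  constructor
  · rintro ⟨-, hd⟩
    have hi : ∀ i, d i = 1 ∨ d i = p := fun i =>
      (Nat.dvd_prime hp).1 (hd ▸ Finset.dvd_lcm (Finset.mem_univ i))
    refine ⟨hi, ?_⟩
    by_contra! hne
    have hdvd : p ∣ 1 := hd ▸ Finset.lcm_dvd fun i _ =>
      Nat.dvd_one.2 ((hi i).resolve_right (hne i))
    exact hp.one_lt.ne' (Nat.dvd_one.1 hdvd)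
  · rintro ⟨hd, i, hi⟩
    refine ⟨hp.ne_zero, Nat.dvd_antisymm (Finset.lcm_dvd fun j _ => ?_) ?_⟩
    · rcases hd j with hj | hj <;> simp [hj]
    · exact (dvd_of_eq hi.symm).trans (Finset.dvd_lcm (Finset.mem_univ i))

theorem admissible_one_prime_iff {p : ℕ} (a : ℕ) {d : Fin r → ℕ}
    (hd : ∀ i, d i = 1 ∨ d i = p) :
    Admissible k h 1 a d ↔ ∀ i j, d i = p → d j = p → h i % p ^ k = h j % p ^ k := by
  simp only [Admissible, Nat.gcd_one_left, one_dvd, implies_true, and_true]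
  refine forall₂_congr fun i j => ?_
  have hmod : (((p ^ k : ℕ) : ℤ) ∣ (h i : ℤ) - h j) ↔ h i % p ^ k = h j % p ^ k := by
    rw [← Nat.modEq_iff_dvd]
    exact eq_comm
  constructor
  · intro H hi hj
    rw [hi, hj, Nat.gcd_self] at H
    exact hmod.1 H
  · intro H
    rcases hd i with hi | hi
    · simp [hi]
    rcases hd j with hj | hj
    · simp [hj]
    rw [hi, hj, Nat.gcd_self]
    exact hmod.2 (H hi hj)

theorem moebiusSum_one_prime (hr : 1 ≤ r) (a : ℕ) {p : ℕ} (hp : p.Prime) :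
    moebiusSum k h 1 a p = -(Rp k r h p : ℝ) := by
  set fiber : ℕ → Finset (Fin r) := fun c => Finset.univ.filter fun i => h i % p ^ k = c
    with hfiber
  set classes := (Finset.univ : Finset (Fin r)).image fun i => h i % p ^ k
  have hp1 : p ≠ 1 := hp.one_lt.ne'
  have hdisj : (classes : Set ℕ).PairwiseDisjoint fun c => (fiber c).powerset.erase ∅ := by
    intro c _ c' _ hcc
    refine Finset.disjoint_left.2 fun S hS hS' => hcc ?_
    simp only [Finset.mem_erase, Finset.mem_powerset] at hS hS'
    obtain ⟨i, hi⟩ := Finset.nonempty_iff_ne_empty.2 hS.1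
    exact (Finset.mem_filter.1 (hS.2 hi)).2.symm.trans (Finset.mem_filter.1 (hS'.2 hi)).2
  have hsum : ∑ S ∈ classes.biUnion fun c => (fiber c).powerset.erase ∅, (-1 : ℝ) ^ S.card =
      -(Rp k r h p : ℝ) := by
    rw [Finset.sum_biUnion hdisj, Finset.sum_congr rfl (g := fun _ => (-1 : ℝ))]
    · simp [Rp, classes]
    · intro c hc
      obtain ⟨i, -, hi⟩ := Finset.mem_image.1 hc
      have hne : (fiber c).Nonempty := ⟨i, by simp [hfiber, hi]⟩
      have h0 : ∑ S ∈ (fiber c).powerset, (-1 : ℝ) ^ S.card = 0 := by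
        exact_mod_cast congrArg (Int.cast : ℤ → ℝ)
          (Finset.sum_powerset_neg_one_pow_card_of_nonempty hne)
      rw [Finset.sum_erase_eq_sub (Finset.empty_mem_powerset _), h0]
      simp
  rw [← hsum, moebiusSum, ← Finset.sum_filter]
  refine Finset.sum_nbij' (fun d => Finset.univ.filter fun i => d i = p)
    (fun S i => if i ∈ S then p else 1) ?_ ?_ ?_ ?_ ?_
  · intro d hd
    rw [Finset.mem_filter, mem_lcmTuples_prime hr hp] at hd
    obtain ⟨⟨hd, i, hi⟩, hadm⟩ := hd
    rw [admissible_one_prime_iff a hd] at hadm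
    refine Finset.mem_biUnion.2 ⟨h i % p ^ k, Finset.mem_image_of_mem _ (Finset.mem_univ i), ?_⟩
    rw [Finset.mem_erase, Finset.mem_powerset, ← Finset.nonempty_iff_ne_empty]
    refine ⟨⟨i, by simp [hi]⟩, fun j hj => ?_⟩
    exact Finset.mem_filter.2 ⟨Finset.mem_univ j, hadm j i (Finset.mem_filter.1 hj).2 hi⟩
  · intro S hS
    obtain ⟨c, -, hS⟩ := Finset.mem_biUnion.1 hS
    rw [Finset.mem_erase, Finset.mem_powerset, ← Finset.nonempty_iff_ne_empty] at hS
    obtain ⟨⟨i, hi⟩, hS⟩ := hS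
    have hd : ∀ i, (if i ∈ S then p else 1) = 1 ∨ (if i ∈ S then p else 1) = p := fun i => by
      split_ifs <;> simp
    have hmem : ∀ i, (if i ∈ S then p else 1) = p → h i % p ^ k = c := fun i hi => by
      split_ifs at hi with hiS
      · exact (Finset.mem_filter.1 (hS hiS)).2
      · exact absurd hi.symm hp1
    rw [Finset.mem_filter, mem_lcmTuples_prime hr hp, admissible_one_prime_iff a hd]
    exact ⟨⟨hd, i, if_pos hi⟩, fun i j hi hj => (hmem i hi).trans (hmem j hj).symm⟩
  · intro d hd
    rw [Finset.mem_filter, mem_lcmTuples_prime hr hp] at hd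
    funext i
    rcases hd.1.1 i with hi | hi <;> simp [hi, hp1.symm]
  · intro S _
    ext i
    by_cases hi : i ∈ S <;> simp [hi, hp1.symm]
  · intro d hd
    rw [Finset.mem_filter, mem_lcmTuples_prime hr hp] at hd
    have hmu : ∀ i, (ArithmeticFunction.moebius (d i) : ℝ) = if d i = p then -1 else 1 :=
      fun i => by
        rcases hd.1.1 i with hi | hi
        · simp [hi, hp1.symm]
        · simp [hi, ArithmeticFunction.moebius_apply_prime hp]
    simp only [hmu]
    rw [← Finset.prod_filter, Finset.prod_const]

theorem rho_eq_eta_one (hk : 2 ≤ k) (hr : 1 ≤ r) (hh : Function.Injective h) :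
    rho k r h = eta k r h 1 0 := by
  have hprod := hasProd_eta hk hr hh le_rfl 0
  have hlocal : ∀ p : Nat.Primes,
      1 + etaCoeff k h 1 0 p = 1 - (Rp k r h (p : ℕ) : ℝ) / (p : ℕ) ^ k := fun p => by
    rw [etaCoeff, moebiusSum_one_prime hr 0 p.2, Nat.gcd_one_left]
    push_cast
    ring
  simp only [hlocal] at hprod
  rw [rho, hprod.tprod_eq, Nat.cast_one, one_mul]

end Series

section GaussSum

theorem eF_add (x y : ℝ) : eF (x + y) = eF x * eF y := by
  rw [eF, eF, eF, ← Complex.exp_add]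
  push_cast
  ring_nf

theorem eF_natCast (n : ℕ) : eF n = 1 := by
  rw [eF, Complex.exp_eq_one_iff]
  exact ⟨n, by push_cast; ring⟩

theorem eF_div_congr {q m n : ℕ} (hq : q ≠ 0) (hmn : m ≡ n [MOD q]) :
    eF ((m : ℝ) / q) = eF ((n : ℝ) / q) := by
  have hq' : (q : ℝ) ≠ 0 := by exact_mod_cast hq
  have hmod : ∀ m : ℕ, eF ((m : ℝ) / q) = eF (((m % q : ℕ) : ℝ) / q) := fun m => by
    have hm : (m : ℝ) = q * (m / q : ℕ) + (m % q : ℕ) := by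
      exact_mod_cast (Nat.div_add_mod m q).symm
    rw [show (m : ℝ) / q = (m / q : ℕ) + ((m % q : ℕ) : ℝ) / q by
      rw [hm]; field_simp, eF_add, eF_natCast, one_mul]
  rw [hmod m, hmod n, hmn]

theorem sum_Icc_eq_sum_range_of_periodic {q : ℕ} {g : ℕ → ℂ}
    (hg : ∀ m n, m ≡ n [MOD q] → g m = g n) :
    ∑ ν ∈ Finset.Icc 1 q, g ν = ∑ ν ∈ Finset.range q, g ν := by
  have h1 : ∑ ν ∈ Finset.Icc 1 q, g ν = ∑ ν ∈ Finset.range q, g (ν + 1) := by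
    rw [Finset.range_eq_Ico, Finset.sum_Ico_add' g 0 q 1]
    rfl
  have h2 := (Finset.sum_range_succ' g q).symm.trans (Finset.sum_range_succ g q)
  rw [hg q 0 (by simp [Nat.ModEq])] at h2
  rw [h1]
  exact add_right_cancel h2

theorem sum_range_mul_of_coprime {q₁ q₂ : ℕ} (hq₁ : q₁ ≠ 0) (hq₂ : q₂ ≠ 0)
    (hq : q₁.Coprime q₂) {f g : ℕ → ℂ} (hf : ∀ m n, m ≡ n [MOD q₁] → f m = f n)
    (hg : ∀ m n, m ≡ n [MOD q₂] → g m = g n) :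
    ∑ ν ∈ Finset.range (q₁ * q₂), f ν * g ν =
      (∑ ν ∈ Finset.range q₁, f ν) * ∑ ν ∈ Finset.range q₂, g ν := by
  rw [Finset.sum_mul_sum, ← Finset.sum_product']
  have hp₁ := Nat.pos_of_ne_zero hq₁
  have hp₂ := Nat.pos_of_ne_zero hq₂
  refine Finset.sum_nbij (fun ν => (ν % q₁, ν % q₂)) ?_ ?_ ?_ ?_
  · intro ν _
    simp [Nat.mod_lt, hp₁, hp₂]
  · intro m hm n hn hmn
    obtain ⟨h1, h2⟩ := Prod.ext_iff.1 hmn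
    exact ((Nat.modEq_and_modEq_iff_modEq_mul hq).1 ⟨h1, h2⟩).eq_of_lt_of_lt
      (by simpa using hm) (by simpa using hn)
  · rintro ⟨x, y⟩ hxy
    obtain ⟨hx, hy⟩ : x < q₁ ∧ y < q₂ := by simpa using hxy
    obtain ⟨ν, h1, h2⟩ := Nat.chineseRemainder hq x y
    refine ⟨ν % (q₁ * q₂), by simpa using Nat.mod_lt _ (Nat.mul_pos hp₁ hp₂), ?_⟩
    refine Prod.ext ?_ ?_
    · change ν % (q₁ * q₂) % q₁ = x
      rw [Nat.mod_mul_right_mod, h1, Nat.mod_eq_of_lt hx]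
    · change ν % (q₁ * q₂) % q₂ = y
      rw [Nat.mod_mul_left_mod, h2, Nat.mod_eq_of_lt hy]
  · intro ν _
    rw [hf ν (ν % q₁) (Nat.mod_modEq _ _).symm, hg ν (ν % q₂) (Nat.mod_modEq _ _).symm]

theorem gsum_summand_congr {k r : ℕ} {h : Fin r → ℕ} {q a : ℕ} (hq : q ≠ 0) (m n : ℕ)
    (hmn : m ≡ n [MOD q]) :
    eF (((a * m : ℕ) : ℝ) / (q : ℝ)) * (eta k r h q m : ℂ) =
      eF (((a * n : ℕ) : ℝ) / (q : ℝ)) * (eta k r h q n : ℂ) := by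
  rw [eF_div_congr hq (hmn.mul_left a), eta_congr hmn]

end GaussSum

/-- quasi-multiplicativity of `𝒢`:
`ρ·𝒢(q₁q₂, a₁q₂ + a₂q₁) = 𝒢(q₁,a₁)·𝒢(q₂,a₂)`. -/
theorem stmt_8 (k r : ℕ) (hk : 2 ≤ k) (hr : 1 ≤ r) (h : Fin r → ℕ) (hh : StrictMono h)
    (hRp : ∀ p : ℕ, p.Prime → Rp k r h p < p ^ k)
    (q₁ q₂ a₁ a₂ : ℕ) (hq₁ : 1 ≤ q₁) (hq₂ : 1 ≤ q₂) (ha₁ : 1 ≤ a₁) (ha₂ : 1 ≤ a₂)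
    (hq : Nat.Coprime q₁ q₂) (h₁ : Nat.gcd a₁ q₁ = 1) (h₂ : Nat.gcd a₂ q₂ = 1) :
    (rho k r h : ℂ) * Gsum k r h (q₁ * q₂) (a₁ * q₂ + a₂ * q₁)
      = Gsum k r h q₁ a₁ * Gsum k r h q₂ a₂ := by

  have h01 : q₁ ≠ 0 := by omega
  have h02 : q₂ ≠ 0 := by omega
  rw [Gsum, Gsum, Gsum,
    sum_Icc_eq_sum_range_of_periodic (gsum_summand_congr (mul_ne_zero h01 h02)),
    sum_Icc_eq_sum_range_of_periodic (gsum_summand_congr h01),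
    sum_Icc_eq_sum_range_of_periodic (gsum_summand_congr h02),
    ← sum_range_mul_of_coprime h01 h02 hq (gsum_summand_congr h01) (gsum_summand_congr h02),
    Finset.mul_sum]
  refine Finset.sum_congr rfl fun ν _ => ?_
  have heta : (rho k r h : ℂ) * eta k r h (q₁ * q₂) ν = eta k r h q₁ ν * eta k r h q₂ ν := by
    rw [rho_eq_eta_one hk hr hh.injective]
    exact_mod_cast eta_one_mul_eta_mul hk hr hh.injective hq₁ hq₂ hq ν
  have hexp : eF ((((a₁ * q₂ + a₂ * q₁) * ν : ℕ) : ℝ) / ((q₁ * q₂ : ℕ) : ℝ)) =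
      eF (((a₁ * ν : ℕ) : ℝ) / (q₁ : ℝ)) * eF (((a₂ * ν : ℕ) : ℝ) / (q₂ : ℝ)) := by
    have h1 : (q₁ : ℝ) ≠ 0 := by exact_mod_cast h01
    have h2 : (q₂ : ℝ) ≠ 0 := by exact_mod_cast h02
    rw [← eF_add]
    congr 1
    push_cast
    field_simp
  rw [hexp]
  linear_combination
    eF (((a₁ * ν : ℕ) : ℝ) / (q₁ : ℝ)) * eF (((a₂ * ν : ℕ) : ℝ) / (q₂ : ℝ)) * heta
end
end

section
/- One has the Euler product identity Σ_{d_1,…,d_r ≥ 1, gcd(d_i^k, d_j^k) ∣ h_i − h_j for all 1 ≤ i,j ≤ r} μ(d_1)⋯μ(d_r)/lcm(d_1^k, …, d_r^k) = ∏_p (1 − R_p·p^{−k}), the product running over all primes p. Consequently, writing ρ for this common value, for every ε > 0 there is a constant C such that for all x ≥ 1: | #{n ≤ x : n ∈ ℛ} − ρ·x | ≤ C·x^{2/(k+1)+ε}. -/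
open scoped BigOperators Classical

noncomputable section

section EulerProduct

/-- Expanding a product over `P` of sums over subsets of `α` as a sum over `α`-tuples of subsets
of `P`. -/
lemma sum_piFinset_powerset_prod {ι α : Type*} [DecidableEq ι] [Fintype α] [DecidableEq α]
    (P : Finset ι) (w : ι → Finset α → ℝ) :
    ∑ A ∈ Fintype.piFinset (fun _ : α => P.powerset),
        ∏ p ∈ P, w p (Finset.univ.filter fun i => p ∈ A i)
      = ∏ p ∈ P, ∑ S : Finset α, w p S := by
  rw [Finset.prod_sum]
  refine Finset.sum_bij' (fun A _ p _ => Finset.univ.filter fun i => p ∈ A i)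
    (fun φ _ i => P.attach.filter (fun p => i ∈ φ p.1 p.2) |>.image Subtype.val) ?_ ?_ ?_ ?_ ?_
  · intro A _
    simp
  · intro φ _
    simp only [Fintype.mem_piFinset, Finset.mem_powerset]
    intro i p hp
    simp only [Finset.mem_image] at hp
    obtain ⟨q, -, rfl⟩ := hp
    exact q.2
  · intro A hA
    simp only [Fintype.mem_piFinset, Finset.mem_powerset] at hA
    funext i
    ext p
    simp only [Finset.mem_image, Finset.mem_filter, Finset.mem_attach, true_and,
      Finset.mem_univ, Subtype.exists, exists_and_left, exists_prop, exists_eq_right_right]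
    exact ⟨fun h => h.1, fun h => ⟨h, hA i h⟩⟩
  · intro φ _
    funext p hp
    ext i
    simp [hp]
  · intro A _
    rw [← Finset.prod_attach]

/-- The tuples of finite subsets of finite sets exhaust all tuples of finite sets. -/
lemma tendsto_piFinset_powerset {ι α : Type*} [DecidableEq ι] [Fintype α] [DecidableEq α] :
    Filter.Tendsto (fun P : Finset ι => Fintype.piFinset (fun _ : α => P.powerset))
      Filter.atTop Filter.atTop := by
  refine Filter.tendsto_atTop_finset_of_monotone ?_ ?_
  · intro P Q hPQ
    exact Fintype.piFinset_subset _ _ fun _ => Finset.powerset_mono.2 hPQ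
  · intro A
    refine ⟨Finset.univ.biUnion A, ?_⟩
    simp only [Fintype.mem_piFinset, Finset.mem_powerset]
    exact fun i => Finset.subset_biUnion_of_mem A (Finset.mem_univ i)

/-- The local weight at `p` of the set `S` of indices `i` with `p ∣ d i`. -/
def localWeight (k r : ℕ) (h : Fin r → ℕ) (p : ℕ) (S : Finset (Fin r)) : ℝ :=
  if ∀ i ∈ S, ∀ j ∈ S, h i % p ^ k = h j % p ^ k then
    (-1) ^ S.card / (if S.Nonempty then (p : ℝ) ^ k else 1) else 0

lemma sum_localWeight (k r : ℕ) (h : Fin r → ℕ) (p : ℕ) :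
    ∑ S, localWeight k r h p S = 1 - (Rp k r h p : ℝ) / (p : ℝ) ^ k := by
  set f : Fin r → ℕ := fun i => h i % p ^ k with hf
  have h0 : localWeight k r h p ∅ = 1 := by simp [localWeight]
  have hset : (Finset.univ.erase (∅ : Finset (Fin r))).filter
      (fun S => ∀ i ∈ S, ∀ j ∈ S, f i = f j)
      = (Finset.univ.image f).biUnion
        (fun c => (Finset.univ.filter fun i => f i = c).powerset.erase ∅) := by
    ext S
    simp only [Finset.mem_filter, Finset.mem_erase, Finset.mem_univ, and_true,
      Finset.mem_biUnion, Finset.mem_image, true_and, Finset.mem_powerset, exists_exists_eq_and]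
    constructor
    · rintro ⟨hS, hc⟩
      obtain ⟨i, hi⟩ := Finset.nonempty_iff_ne_empty.2 hS
      exact ⟨i, hS, fun j hj => by simpa using hc j hj i hi⟩
    · rintro ⟨i, hS, hsub⟩
      refine ⟨hS, fun a ha b hb => ?_⟩
      have h1 := hsub ha
      have h2 := hsub hb
      simp only [Finset.mem_filter, Finset.mem_univ, true_and] at h1 h2
      rw [h1, h2]
  have hdisj : ((Finset.univ.image f : Finset ℕ) : Set ℕ).PairwiseDisjoint
      (fun c => (Finset.univ.filter fun i => f i = c).powerset.erase ∅) := by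
    intro a _ b _ hab
    refine Finset.disjoint_left.2 fun S hSa hSb => hab ?_
    simp only [Finset.mem_erase, Finset.mem_powerset] at hSa hSb
    obtain ⟨i, hi⟩ := Finset.nonempty_iff_ne_empty.2 hSa.1
    have h1 := hSa.2 hi
    have h2 := hSb.2 hi
    simp only [Finset.mem_filter, Finset.mem_univ, true_and] at h1 h2
    rw [← h1, ← h2]
  rw [← Finset.add_sum_erase _ _ (Finset.mem_univ ∅), h0]
  have h1 : ∑ S ∈ Finset.univ.erase ∅, localWeight k r h p S
      = ∑ S ∈ (Finset.univ.erase (∅ : Finset (Fin r))).filter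
          (fun S => ∀ i ∈ S, ∀ j ∈ S, f i = f j), (-1 : ℝ) ^ S.card / (p : ℝ) ^ k := by
    rw [Finset.sum_filter]
    refine Finset.sum_congr rfl fun S hS => ?_
    have hS' : S.Nonempty := Finset.nonempty_iff_ne_empty.2 (Finset.ne_of_mem_erase hS)
    simp only [localWeight, hS', if_true, hf]
  have h2 : ∀ c ∈ Finset.univ.image f,
      ∑ S ∈ (Finset.univ.filter fun i => f i = c).powerset.erase ∅,
        (-1 : ℝ) ^ S.card / (p : ℝ) ^ k = -(1 / (p : ℝ) ^ k) := by
    intro c hc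
    obtain ⟨i, -, hi⟩ := Finset.mem_image.1 hc
    have hne : (Finset.univ.filter fun i => f i = c).Nonempty := ⟨i, by simp [hi]⟩
    have h3 := Finset.sum_powerset_neg_one_pow_card_of_nonempty hne
    have h4 : ∑ S ∈ (Finset.univ.filter fun i => f i = c).powerset, (-1 : ℝ) ^ S.card = 0 := by
      exact_mod_cast h3
    rw [← Finset.add_sum_erase _ _ (Finset.empty_mem_powerset _)] at h4
    rw [← Finset.sum_div]
    simp only [Finset.card_empty, pow_zero] at h4
    rw [eq_neg_of_add_eq_zero_right h4, neg_div]
  rw [h1, hset, Finset.sum_biUnion hdisj, Finset.sum_congr rfl h2, Finset.sum_const]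
  simp only [Rp, hf, nsmul_eq_mul]
  ring

lemma abs_localWeight_le (k r : ℕ) (h : Fin r → ℕ) (p : ℕ) (S : Finset (Fin r)) :
    |localWeight k r h p S| ≤ if S = ∅ then 1 else 1 / (p : ℝ) ^ k := by
  unfold localWeight
  rcases S.eq_empty_or_nonempty with rfl | hS
  · simp
  · rw [if_neg hS.ne_empty]
    split_ifs
    · rw [abs_div, abs_pow]; simp
    · simp

lemma Rp_le (k r : ℕ) (h : Fin r → ℕ) (p : ℕ) : Rp k r h p ≤ r := by
  unfold Rp
  exact Finset.card_image_le.trans (by simp)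

lemma summable_primes_pow {k : ℕ} (hk : 2 ≤ k) :
    Summable fun p : Nat.Primes => 1 / ((p : ℕ) : ℝ) ^ k := by
  have h := (Real.summable_one_div_nat_pow (p := k)).2 (by omega)
  exact h.comp_injective Nat.Primes.coe_nat_injective

lemma multipliable_euler {k : ℕ} (hk : 2 ≤ k) (r : ℕ) (h : Fin r → ℕ) :
    Multipliable fun p : Nat.Primes => 1 - (Rp k r h (p : ℕ) : ℝ) / (p : ℕ) ^ k := by
  simp only [sub_eq_add_neg]
  refine multipliable_one_add_of_summable ?_
  refine Summable.of_nonneg_of_le (fun _ => norm_nonneg _) (fun p => ?_)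
    ((summable_primes_pow hk).mul_left (r : ℝ))
  rw [norm_neg, Real.norm_of_nonneg (by positivity), mul_one_div]
  gcongr
  exact Rp_le _ _ _ _

end EulerProduct

section EulerProductTuples

/-- The squarefree number whose set of prime factors is `A`. -/
def primesProd (A : Finset Nat.Primes) : ℕ := ∏ p ∈ A, (p : ℕ)

lemma coprime_of_primes_ne {p q : Nat.Primes} (hpq : p ≠ q) : Nat.Coprime (p : ℕ) (q : ℕ) :=
  (Nat.coprime_primes p.2 q.2).2 fun h => hpq (Nat.Primes.coe_nat_injective h)

lemma primesProd_pos (A : Finset Nat.Primes) : 0 < primesProd A :=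
  Finset.prod_pos fun p _ => p.2.pos

lemma dvd_primesProd_iff (A : Finset Nat.Primes) (p : Nat.Primes) :
    (p : ℕ) ∣ primesProd A ↔ p ∈ A := by
  constructor
  · intro h
    obtain ⟨q, hq, hpq⟩ := (p.2.prime.dvd_finsetProd_iff _).1 h
    have : p = q := Nat.Primes.coe_nat_injective ((Nat.prime_dvd_prime_iff_eq p.2 q.2).1 hpq)
    rwa [this]
  · exact fun h => Finset.dvd_prod_of_mem _ h

lemma primesProd_injective : Function.Injective primesProd := by
  intro A B hAB
  ext p
  rw [← dvd_primesProd_iff, ← dvd_primesProd_iff, hAB]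

lemma exists_primesProd_eq {n : ℕ} (hn : Squarefree n) : ∃ A, primesProd A = n := by
  exact ⟨n.primeFactors.subtype Nat.Prime,
    (Finset.prod_subtype_of_mem (fun p => p) fun _ hp => Nat.prime_of_mem_primeFactors hp).trans
      (Nat.prod_primeFactors_of_squarefree hn)⟩

lemma moebius_primesProd (A : Finset Nat.Primes) :
    ArithmeticFunction.moebius (primesProd A) = (-1) ^ A.card := by
  unfold primesProd
  rw [ArithmeticFunction.isMultiplicative_moebius.map_prod]
  · rw [Finset.prod_congr rfl fun p _ => ArithmeticFunction.moebius_apply_prime p.2,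
      Finset.prod_const]
  · intro p _ q _ hpq
    exact coprime_of_primes_ne hpq

lemma gcd_primesProd (A B : Finset Nat.Primes) :
    Nat.gcd (primesProd A) (primesProd B) = primesProd (A ∩ B) := by
  have hA : primesProd A = primesProd (A ∩ B) * primesProd (A \ B) :=
    (Finset.prod_inter_mul_prod_sdiff A B _).symm
  have hB : primesProd B = primesProd (A ∩ B) * primesProd (B \ A) := by
    rw [Finset.inter_comm]
    exact (Finset.prod_inter_mul_prod_sdiff B A _).symm
  rw [hA, hB, Nat.gcd_mul_left]
  have : Nat.Coprime (primesProd (A \ B)) (primesProd (B \ A)) := by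
    refine Nat.Coprime.prod_left fun p hp => Nat.Coprime.prod_right fun q hq =>
      coprime_of_primes_ne ?_
    rintro rfl
    simp only [Finset.mem_sdiff] at hp hq
    exact hp.2 hq.1
  rw [this.gcd_eq_one, mul_one]

lemma primesProd_pow_dvd_iff (k : ℕ) (A : Finset Nat.Primes) (z : ℤ) :
    ((primesProd A ^ k : ℕ) : ℤ) ∣ z ↔ ∀ p ∈ A, (((p : ℕ) ^ k : ℕ) : ℤ) ∣ z := by
  simp only [Int.natCast_dvd]
  constructor
  · intro h p hp
    exact (pow_dvd_pow_of_dvd ((dvd_primesProd_iff A p).2 hp) k).trans h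
  · intro h
    unfold primesProd
    rw [← Finset.prod_pow]
    refine Finset.prod_dvd_of_isRelPrime (fun p _ q _ hpq => ?_) h
    exact Nat.coprime_iff_isRelPrime.1 ((coprime_of_primes_ne hpq).pow k k)

lemma lcm_primesProd_pow {r : ℕ} (k : ℕ) (P : Finset Nat.Primes) (A : Fin r → Finset Nat.Primes)
    (hA : ∀ i, A i ⊆ P) :
    (Finset.univ.lcm fun i => primesProd (A i) ^ k)
      = ∏ p ∈ P, if (Finset.univ.filter fun i => p ∈ A i).Nonempty then (p : ℕ) ^ k else 1 := by
  refine Nat.dvd_antisymm (Finset.lcm_dvd fun i _ => ?_) ?_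
  · rw [primesProd, ← Finset.prod_pow]
    have : ∏ p ∈ A i, (p : ℕ) ^ k = ∏ p ∈ A i,
        if (Finset.univ.filter fun i => p ∈ A i).Nonempty then (p : ℕ) ^ k else 1 := by
      refine Finset.prod_congr rfl fun p hp => ?_
      rw [if_pos ⟨i, by simpa using hp⟩]
    rw [this]
    exact Finset.prod_dvd_prod_of_subset _ _ _ (hA i)
  · refine Finset.prod_dvd_of_isRelPrime (fun p _ q _ hpq => ?_) fun p _ => ?_
    · refine Nat.coprime_iff_isRelPrime.1 ?_
      have := (coprime_of_primes_ne hpq).pow k k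
      beta_reduce
      split_ifs
      exacts [this, Nat.coprime_one_right _, Nat.coprime_one_left _, Nat.coprime_one_left _]
    · split_ifs with hp
      · obtain ⟨i, hi⟩ := hp
        have hi' : p ∈ A i := by simpa using hi
        exact (pow_dvd_pow_of_dvd ((dvd_primesProd_iff _ p).2 hi') k).trans
          (Finset.dvd_lcm (f := fun i => primesProd (A i) ^ k) (Finset.mem_univ i))
      · exact one_dvd _

/-- The summand of the multiple series for the density of the `k`-free tuples. -/
def tupleTerm (k r : ℕ) (h : Fin r → ℕ) (d : Fin r → ℕ) : ℝ :=
  if (∀ i, 1 ≤ d i) ∧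
      (∀ i j, ((Nat.gcd (d i ^ k) (d j ^ k) : ℤ) ∣ (h i : ℤ) - (h j : ℤ)))
  then (∏ i, (ArithmeticFunction.moebius (d i) : ℝ)) /
        (((Finset.univ.lcm fun i => d i ^ k) : ℕ) : ℝ)
  else 0

lemma tupleTerm_primesProd (k r : ℕ) (h : Fin r → ℕ) (P : Finset Nat.Primes)
    (A : Fin r → Finset Nat.Primes) (hA : ∀ i, A i ⊆ P) :
    tupleTerm k r h (fun i => primesProd (A i))
      = ∏ p ∈ P, localWeight k r h (p : ℕ) (Finset.univ.filter fun i => p ∈ A i) := by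
  have hcond : ((∀ i, 1 ≤ primesProd (A i)) ∧
      (∀ i j, ((Nat.gcd (primesProd (A i) ^ k) (primesProd (A j) ^ k) : ℤ) ∣
        (h i : ℤ) - (h j : ℤ)))) ↔
      ∀ p ∈ P, ∀ i ∈ Finset.univ.filter (fun i => p ∈ A i),
        ∀ j ∈ Finset.univ.filter (fun i => p ∈ A i), h i % (p : ℕ) ^ k = h j % (p : ℕ) ^ k := by
    have hmod (p : Nat.Primes) (i j : Fin r) : h i % (p : ℕ) ^ k = h j % (p : ℕ) ^ k ↔
        (((p : ℕ) ^ k : ℕ) : ℤ) ∣ (h i : ℤ) - (h j : ℤ) := by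
      rw [← Nat.modEq_iff_dvd]
      exact eq_comm
    simp only [Nat.pow_gcd_pow, gcd_primesProd, primesProd_pow_dvd_iff, hmod]
    simp only [Finset.mem_filter, Finset.mem_univ, true_and, Finset.mem_inter]
    constructor
    · rintro ⟨-, h2⟩ p _ i hi j hj
      exact h2 i j p ⟨hi, hj⟩
    · intro h2
      exact ⟨fun i => primesProd_pos _, fun i j p hp => h2 p (hA i hp.1) i hp.1 j hp.2⟩
  unfold tupleTerm
  by_cases hc : ∀ p ∈ P, ∀ i ∈ Finset.univ.filter (fun i => p ∈ A i),
        ∀ j ∈ Finset.univ.filter (fun i => p ∈ A i), h i % (p : ℕ) ^ k = h j % (p : ℕ) ^ k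
  · rw [if_pos (hcond.2 hc), lcm_primesProd_pow k P A hA]
    have h1 : ∏ i, (ArithmeticFunction.moebius (primesProd (A i)) : ℝ)
        = ∏ p ∈ P, (-1 : ℝ) ^ (Finset.univ.filter fun i => p ∈ A i).card := by
      have e1 : ∀ i, (ArithmeticFunction.moebius (primesProd (A i)) : ℝ)
          = ∏ p ∈ P, if p ∈ A i then (-1 : ℝ) else 1 := by
        intro i
        rw [moebius_primesProd, Finset.prod_ite_mem, Finset.inter_eq_right.2 (hA i),
          Finset.prod_const]
        push_cast
        rfl
      rw [Finset.prod_congr rfl fun i _ => e1 i, Finset.prod_comm]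
      refine Finset.prod_congr rfl fun p _ => ?_
      rw [Finset.prod_ite, Finset.prod_const, Finset.prod_const_one, mul_one]
    rw [h1, Nat.cast_prod, ← Finset.prod_div_distrib]
    refine Finset.prod_congr rfl fun p hp => ?_
    rw [localWeight, if_pos (hc p hp)]
    push_cast
    rfl
  · rw [if_neg (fun h' => hc (hcond.1 h'))]
    push Not at hc
    obtain ⟨p, hp, i, hi, j, hj, hne⟩ := hc
    refine (Finset.prod_eq_zero hp ?_).symm
    rw [localWeight, if_neg]
    exact fun h' => hne (h' i hi j hj)

lemma sum_tupleTerm (k r : ℕ) (h : Fin r → ℕ) (P : Finset Nat.Primes) :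
    ∑ A ∈ Fintype.piFinset (fun _ : Fin r => P.powerset),
        tupleTerm k r h (fun i => primesProd (A i))
      = ∏ p ∈ P, (1 - (Rp k r h (p : ℕ) : ℝ) / (p : ℕ) ^ k) := by
  rw [← Finset.prod_congr rfl fun (p : Nat.Primes) _ => sum_localWeight k r h (p : ℕ),
    ← sum_piFinset_powerset_prod P (fun p => localWeight k r h (p : ℕ))]
  refine Finset.sum_congr rfl fun A hA => tupleTerm_primesProd k r h P A ?_
  simpa using hA

lemma summable_tupleTerm {k : ℕ} (hk : 2 ≤ k) (r : ℕ) (h : Fin r → ℕ) :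
    Summable fun A : Fin r → Finset Nat.Primes => tupleTerm k r h (fun i => primesProd (A i)) := by
  have hs := (summable_primes_pow hk).mul_left ((2 : ℝ) ^ r)
  refine Summable.of_abs
    (summable_of_sum_le (c := Real.exp (∑' p : Nat.Primes, 2 ^ r * (1 / ((p : ℕ) : ℝ) ^ k)))
    (fun _ => abs_nonneg _) fun u => ?_)
  set P : Finset Nat.Primes := u.biUnion fun A => Finset.univ.biUnion A with hP
  have hu : u ⊆ Fintype.piFinset (fun _ : Fin r => P.powerset) := by
    intro A hA
    simp only [Fintype.mem_piFinset, Finset.mem_powerset, hP]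
    intro i p hp
    simp only [Finset.mem_biUnion, Finset.mem_univ, true_and]
    exact ⟨A, hA, i, hp⟩
  calc ∑ A ∈ u, |tupleTerm k r h (fun i => primesProd (A i))|
      ≤ ∑ A ∈ Fintype.piFinset (fun _ : Fin r => P.powerset),
          |tupleTerm k r h (fun i => primesProd (A i))| :=
        Finset.sum_le_sum_of_subset_of_nonneg hu fun _ _ _ => abs_nonneg _
    _ = ∏ p ∈ P, ∑ S, |localWeight k r h (p : ℕ) S| := by
        rw [← sum_piFinset_powerset_prod P (fun p S => |localWeight k r h (p : ℕ) S|)]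
        refine Finset.sum_congr rfl fun A hA => ?_
        rw [tupleTerm_primesProd k r h P A (by simpa using hA), Finset.abs_prod]
    _ ≤ ∏ p ∈ P, Real.exp (2 ^ r * (1 / ((p : ℕ) : ℝ) ^ k)) := by
        refine Finset.prod_le_prod (fun p _ => Finset.sum_nonneg fun _ _ => abs_nonneg _)
          fun p _ => ?_
        calc ∑ S, |localWeight k r h (p : ℕ) S|
            ≤ ∑ S : Finset (Fin r), ((if S = ∅ then 1 else 0) + 1 / ((p : ℕ) : ℝ) ^ k) := by
              refine Finset.sum_le_sum fun S _ => (abs_localWeight_le k r h p S).trans ?_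
              split_ifs
              · have : (0 : ℝ) ≤ 1 / ((p : ℕ) : ℝ) ^ k := by positivity
                linarith
              · simp
          _ = 2 ^ r * (1 / ((p : ℕ) : ℝ) ^ k) + 1 := by
              rw [Finset.sum_add_distrib, Finset.sum_ite_eq' Finset.univ, Finset.sum_const]
              simp only [Finset.mem_univ, if_true, Finset.card_univ, Fintype.card_finset,
                Fintype.card_fin, nsmul_eq_mul]
              push_cast
              ring
          _ ≤ _ := Real.add_one_le_exp _
    _ = Real.exp (∑ p ∈ P, 2 ^ r * (1 / ((p : ℕ) : ℝ) ^ k)) := (Real.exp_sum _ _).symm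
    _ ≤ _ := Real.exp_le_exp.2 (hs.sum_le_tsum _ fun _ _ => by positivity)

/-- The Euler product for the density of the `k`-free tuples. -/
theorem tsum_tupleTerm {k : ℕ} (hk : 2 ≤ k) (r : ℕ) (h : Fin r → ℕ) :
    ∑' d, tupleTerm k r h d = ∏' p : Nat.Primes, (1 - (Rp k r h (p : ℕ) : ℝ) / (p : ℕ) ^ k) := by
  have hinj : Function.Injective
      (fun (A : Fin r → Finset Nat.Primes) (i : Fin r) => primesProd (A i)) :=
    fun A B hAB => funext fun i => primesProd_injective (congrFun hAB i)
  rw [← hinj.tsum_eq (f := tupleTerm k r h)]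
  · have h1 := (summable_tupleTerm hk r h).hasSum.comp
      (tendsto_piFinset_powerset (ι := Nat.Primes) (α := Fin r))
    have h2 := (multipliable_euler hk r h).hasProd
    refine tendsto_nhds_unique h1 ?_
    refine Filter.Tendsto.congr (fun P => ?_) h2
    exact (sum_tupleTerm k r h P).symm
  · intro d hd
    have hsq : ∀ i, Squarefree (d i) := by
      intro i
      by_contra hi
      refine hd ?_
      unfold tupleTerm
      rw [Finset.prod_eq_zero (Finset.mem_univ i)
        (by rw [ArithmeticFunction.moebius_eq_zero_of_not_squarefree hi, Int.cast_zero])]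
      simp
    choose A hA using fun i => exists_primesProd_eq (hsq i)
    exact ⟨A, funext hA⟩

end EulerProductTuples

section ResidueCount

/-- Every prime factor `p` of `D` satisfies `p ^ k ∣ n + h i` for some `i`. -/
def Hits (k r : ℕ) (h : Fin r → ℕ) (D n : ℕ) : Prop :=
  ∀ p ∈ D.primeFactors, ∃ i, p ^ k ∣ n + h i

/-- The number of residue classes modulo `D ^ k` satisfying `Hits`, for squarefree `D`. -/
def residueCount (k r : ℕ) (h : Fin r → ℕ) (D : ℕ) : ℕ := ∏ p ∈ D.primeFactors, Rp k r h p

lemma hits_mod {k r : ℕ} {h : Fin r → ℕ} {D M : ℕ} (hDM : D ^ k ∣ M) (n : ℕ) :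
    Hits k r h D (n % M) ↔ Hits k r h D n := by
  refine forall₂_congr fun p hp => exists_congr fun i => ?_
  have hpM : p ^ k ∣ M := (pow_dvd_pow_of_dvd (Nat.dvd_of_mem_primeFactors hp) k).trans hDM
  have : n % M + h i ≡ n + h i [MOD p ^ k] :=
    ((Nat.mod_modEq n M).of_dvd hpM).add_right _
  exact this.dvd_iff dvd_rfl

lemma card_hits_mul {k r : ℕ} {h : Fin r → ℕ} {a b : ℕ} (ha : a ≠ 0) (hb : b ≠ 0)
    (hab : a.Coprime b) :
    ((Finset.range ((a * b) ^ k)).filter (Hits k r h (a * b))).card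
      = ((Finset.range (a ^ k)).filter (Hits k r h a)).card
        * ((Finset.range (b ^ k)).filter (Hits k r h b)).card := by
  have hak : a ^ k ≠ 0 := pow_ne_zero _ ha
  have hbk : b ^ k ≠ 0 := pow_ne_zero _ hb
  have hco : (a ^ k).Coprime (b ^ k) := hab.pow k k
  have hmul (n : ℕ) : Hits k r h (a * b) n ↔ Hits k r h a n ∧ Hits k r h b n := by
    simp only [Hits, hab.primeFactors_mul, Finset.mem_union]
    exact ⟨fun H => ⟨fun p hp => H p (Or.inl hp), fun p hp => H p (Or.inr hp)⟩,
      fun H p hp => hp.elim (H.1 p) (H.2 p)⟩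
  rw [← Finset.card_product]
  refine Finset.card_bij (fun n _ => (n % a ^ k, n % b ^ k)) ?_ ?_ ?_
  · intro n hn
    simp only [Finset.mem_filter, hmul] at hn
    simp only [Finset.mem_product, Finset.mem_filter, Finset.mem_range, hits_mod dvd_rfl]
    exact ⟨⟨Nat.mod_lt _ (Nat.pos_of_ne_zero hak), hn.2.1⟩,
      ⟨Nat.mod_lt _ (Nat.pos_of_ne_zero hbk), hn.2.2⟩⟩
  · intro m hm n hn hmn
    simp only [Finset.mem_filter, Finset.mem_range, mul_pow] at hm hn
    simp only [Prod.mk.injEq] at hmn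
    exact Nat.ModEq.eq_of_lt_of_lt
      ((Nat.modEq_and_modEq_iff_modEq_mul hco).1 ⟨hmn.1, hmn.2⟩) hm.1 hn.1
  · rintro ⟨u, v⟩ huv
    simp only [Finset.mem_product, Finset.mem_filter, Finset.mem_range] at huv
    have hs := (Nat.chineseRemainder hco u v).2
    have hlt := Nat.chineseRemainder_lt_mul hco u v hak hbk
    set t : ℕ := (Nat.chineseRemainder hco u v : ℕ)
    have h1 : t % a ^ k = u := Nat.mod_eq_of_modEq hs.1 huv.1.1
    have h2 : t % b ^ k = v := Nat.mod_eq_of_modEq hs.2 huv.2.1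
    refine ⟨t, ?_, by rw [h1, h2]⟩
    simp only [Finset.mem_filter, Finset.mem_range, hmul, mul_pow]
    refine ⟨hlt, ?_, ?_⟩
    · rw [← hits_mod dvd_rfl, h1]; exact huv.1.2
    · rw [← hits_mod dvd_rfl, h2]; exact huv.2.2

lemma card_hits_prime {k r : ℕ} {h : Fin r → ℕ} {p : ℕ} (hp : p.Prime) :
    ((Finset.range (p ^ k)).filter (Hits k r h p)).card = Rp k r h p := by
  have hq : 0 < p ^ k := pow_pos hp.pos k
  have hhits (n : ℕ) : Hits k r h p n ↔ ∃ i, p ^ k ∣ n + h i := by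
    simp [Hits, hp.primeFactors]
  simp only [hhits]
  unfold Rp
  generalize p ^ k = q at hq
  have hneg (n : ℕ) (hn : n ≤ q) : (q - n) % q + n ≡ 0 [MOD q] := by
    calc (q - n) % q + n ≡ (q - n) + n [MOD q] := (Nat.mod_modEq _ _).add_right n
      _ = q := Nat.sub_add_cancel hn
      _ ≡ 0 [MOD q] := by simp [Nat.ModEq]
  refine Finset.card_bij (fun n _ => (q - n) % q) ?_ ?_ ?_
  · intro n hn
    simp only [Finset.mem_filter, Finset.mem_range] at hn
    obtain ⟨hn, i, hi⟩ := hn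
    refine Finset.mem_image.2 ⟨i, Finset.mem_univ i, ?_⟩
    have h1 : h i + n ≡ 0 [MOD q] := by
      rw [add_comm]; exact (Nat.modEq_zero_iff_dvd).2 hi
    have h2 : h i ≡ (q - n) % q [MOD q] :=
      Nat.ModEq.add_right_cancel' n (h1.trans (hneg n hn.le).symm)
    rw [Nat.mod_eq_of_modEq h2 (Nat.mod_lt _ hq)]
  · intro m hm n hn hmn
    simp only [Finset.mem_filter, Finset.mem_range] at hm hn
    refine Nat.ModEq.eq_of_lt_of_lt (m := q) ?_ hm.1 hn.1
    refine Nat.ModEq.add_left_cancel' ((q - m) % q) ((hneg m hm.1.le).trans ?_)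
    rw [hmn]
    exact (hneg n hn.1.le).symm
  · intro c hc
    obtain ⟨i, -, rfl⟩ := Finset.mem_image.1 hc
    have hlt : h i % q < q := Nat.mod_lt _ hq
    have h1 := hneg (h i % q) hlt.le
    have hlt' : (q - h i % q) % q < q := Nat.mod_lt _ hq
    refine ⟨(q - h i % q) % q, ?_, ?_⟩
    · simp only [Finset.mem_filter, Finset.mem_range]
      refine ⟨hlt', i, (Nat.modEq_zero_iff_dvd).1 ?_⟩
      exact ((Nat.mod_modEq (h i) q).symm.add_left _).trans h1
    · have h2 := hneg _ hlt'.le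
      rw [add_comm] at h1
      have h3 : (q - (q - h i % q) % q) % q ≡ h i % q [MOD q] :=
        Nat.ModEq.add_right_cancel' _ (h2.trans h1.symm)
      exact Nat.ModEq.eq_of_lt_of_lt h3 (Nat.mod_lt _ hq) hlt

lemma card_hits {k r : ℕ} {h : Fin r → ℕ} {D : ℕ} (hD : Squarefree D) :
    ((Finset.range (D ^ k)).filter (Hits k r h D)).card = residueCount k r h D := by
  induction D using Nat.recOnPosPrimePosCoprime with
  | prime_pow p n hp hn =>
    have : n = 1 := ((Nat.squarefree_pow_iff hp.ne_one hn.ne').1 hD).2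
    subst this
    rw [pow_one, card_hits_prime hp, residueCount, hp.primeFactors, Finset.prod_singleton]
  | zero => exact absurd hD not_squarefree_zero
  | one =>
    have hall (n : ℕ) : Hits k r h 1 n := by simp [Hits]
    rw [Finset.filter_true_of_mem fun n _ => hall n]
    simp [residueCount]
  | coprime a b ha hb hab iha ihb =>
    rw [card_hits_mul (by omega) (by omega) hab, iha (hD.squarefree_of_dvd (dvd_mul_right a b)),
      ihb (hD.squarefree_of_dvd (dvd_mul_left b a)), residueCount, residueCount, residueCount,
      hab.primeFactors_mul, Finset.prod_union hab.disjoint_primeFactors]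

lemma abs_card_mod_sub_le {x : ℝ} (hx : 0 ≤ x) {M c : ℕ} (hM : 0 < M) (hc : c < M) :
    |(((Finset.Icc 1 ⌊x⌋₊).filter fun n => n % M = c).card : ℝ) - x / M| ≤ 2 := by
  have hset : ((Finset.Icc 1 ⌊x⌋₊).filter fun n => n % M = c)
      = (Finset.Ioc 0 ⌊x⌋₊).filter fun n => n ≡ c [MOD M] := by
    ext n
    simp only [Finset.mem_filter, Finset.mem_Icc, Finset.mem_Ioc, Nat.ModEq,
      Nat.mod_eq_of_lt hc]
    rfl
  have hcard := Nat.Ioc_filter_modEq_card 0 ⌊x⌋₊ hM c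
  rw [hset]
  set m := ((Finset.Ioc 0 ⌊x⌋₊).filter fun n => n ≡ c [MOD M]).card
  have hMQ : (0 : ℚ) < M := by exact_mod_cast hM
  have hMR : (1 : ℝ) ≤ M := by exact_mod_cast hM
  have hdiff : ((⌊x⌋₊ : ℚ) - c) / M - (((0 : ℕ) : ℚ) - c) / M = (⌊x⌋₊ : ℚ) / M := by
    push_cast; ring
  have hnn : (0 : ℚ) ≤ (⌊x⌋₊ : ℚ) / M := by positivity
  have f1 := Int.floor_le (((⌊x⌋₊ : ℚ) - c) / M)
  have f2 := Int.lt_floor_add_one (((⌊x⌋₊ : ℚ) - c) / M)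
  have f3 := Int.floor_le ((((0 : ℕ) : ℚ) - c) / M)
  have f4 := Int.lt_floor_add_one ((((0 : ℕ) : ℚ) - c) / M)
  rw [max_eq_left (sub_nonneg.2 (Int.floor_le_floor (by linarith)))] at hcard
  have hcardQ : (m : ℚ) = (⌊((⌊x⌋₊ : ℚ) - c) / M⌋ : ℚ) - (⌊(((0 : ℕ) : ℚ) - c) / M⌋ : ℚ) := by
    exact_mod_cast hcard
  have u1 : (m : ℝ) ≤ (⌊x⌋₊ : ℝ) / M + 1 := by
    have : (m : ℚ) ≤ (⌊x⌋₊ : ℚ) / M + 1 := by linarith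
    simpa using (Rat.cast_le (K := ℝ)).2 this
  have u2 : (⌊x⌋₊ : ℝ) / M - 1 ≤ m := by
    have : (⌊x⌋₊ : ℚ) / M - 1 ≤ m := by linarith
    simpa using (Rat.cast_le (K := ℝ)).2 this
  have g1 : (⌊x⌋₊ : ℝ) / M ≤ x / M := by gcongr; exact Nat.floor_le hx
  have g2 : x / M ≤ (⌊x⌋₊ : ℝ) / M + 1 := by
    have h1 : x / M ≤ ((⌊x⌋₊ : ℝ) + 1) / M := by gcongr; exact (Nat.lt_floor_add_one x).le
    have h2 : (1 : ℝ) / M ≤ 1 := by rw [div_le_one (by linarith)]; exact hMR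
    rw [add_div] at h1
    linarith
  rw [abs_le]
  constructor <;> linarith

lemma abs_card_hits_sub_le {k r : ℕ} {h : Fin r → ℕ} {D : ℕ} (hD : Squarefree D) {x : ℝ}
    (hx : 0 ≤ x) :
    |(((Finset.Icc 1 ⌊x⌋₊).filter (Hits k r h D)).card : ℝ)
        - residueCount k r h D * x / (D : ℝ) ^ k| ≤ 2 * residueCount k r h D := by
  have hM : 0 < D ^ k := pow_pos (Nat.pos_of_ne_zero hD.ne_zero) k
  set T := (Finset.range (D ^ k)).filter (Hits k r h D) with hT
  have hcard : ((Finset.Icc 1 ⌊x⌋₊).filter (Hits k r h D)).card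
      = ∑ c ∈ T, ((Finset.Icc 1 ⌊x⌋₊).filter fun n => n % D ^ k = c).card := by
    rw [Finset.card_eq_sum_card_fiberwise (f := fun n => n % D ^ k) (t := T)]
    · refine Finset.sum_congr rfl fun c hc => ?_
      rw [Finset.filter_filter]
      congr 1
      refine Finset.filter_congr fun n _ => ⟨fun H => H.2, fun H => ⟨?_, H⟩⟩
      rw [← hits_mod dvd_rfl, H]
      exact (Finset.mem_filter.1 hc).2
    · intro n hn
      simp only [Finset.coe_filter, Set.mem_ofPred_eq] at hn
      simp only [hT, Finset.coe_filter, Set.mem_ofPred_eq, Finset.mem_range, hits_mod dvd_rfl]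
      exact ⟨Nat.mod_lt _ hM, hn.2⟩
  have hTc : (T.card : ℝ) = residueCount k r h D := by rw [hT, card_hits hD]
  have hsub : (((Finset.Icc 1 ⌊x⌋₊).filter (Hits k r h D)).card : ℝ)
        - residueCount k r h D * x / (D : ℝ) ^ k
      = ∑ c ∈ T, ((((Finset.Icc 1 ⌊x⌋₊).filter fun n => n % D ^ k = c).card : ℝ)
          - x / ((D ^ k : ℕ) : ℝ)) := by
    rw [Finset.sum_sub_distrib, Finset.sum_const, hcard, nsmul_eq_mul, hTc]
    push_cast
    ring
  rw [hsub]
  calc _ ≤ ∑ c ∈ T, |_| := Finset.abs_sum_le_sum_abs _ _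
    _ ≤ ∑ c ∈ T, (2 : ℝ) := Finset.sum_le_sum fun c hc =>
        abs_card_mod_sub_le hx hM (Finset.mem_range.1 (Finset.mem_filter.1 hc).1)
    _ = 2 * residueCount k r h D := by
        rw [Finset.sum_const, nsmul_eq_mul, hTc]; ring

/-- Multiples of `q` among `n + a`, `1 ≤ n ≤ N`. -/
lemma card_dvd_add_le (N a q : ℕ) :
    ((Finset.Icc 1 N).filter fun n => q ∣ n + a).card ≤ (N + a) / q := by
  rw [← Nat.Ioc_filter_dvd_card_eq_div]
  refine Finset.card_le_card_of_injOn (fun n => n + a) ?_ fun _ _ _ _ hab => Nat.add_right_cancel hab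
  intro n hn
  simp only [Finset.coe_filter, Finset.mem_Icc, Set.mem_ofPred_eq] at hn
  simp only [Finset.coe_filter, Finset.mem_Ioc, Set.mem_ofPred_eq]
  exact ⟨by omega, hn.2⟩

lemma card_hits_prime_le {k r : ℕ} {h : Fin r → ℕ} {p : ℕ} (hp : p.Prime) {X : ℝ} {N : ℕ}
    (hX : ∀ i, ((N + h i : ℕ) : ℝ) ≤ X) :
    (((Finset.Icc 1 N).filter (Hits k r h p)).card : ℝ) ≤ r * (X / (p : ℝ) ^ k) := by
  have hsub : (Finset.Icc 1 N).filter (Hits k r h p) ⊆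
      Finset.univ.biUnion fun i => (Finset.Icc 1 N).filter fun n => p ^ k ∣ n + h i := by
    intro n hn
    simp only [Finset.mem_filter, Hits, hp.primeFactors, Finset.mem_singleton,
      forall_eq] at hn
    obtain ⟨i, hi⟩ := hn.2
    exact Finset.mem_biUnion.2 ⟨i, Finset.mem_univ i, Finset.mem_filter.2 ⟨hn.1, hi⟩⟩
  have h1 := (Finset.card_le_card hsub).trans Finset.card_biUnion_le
  calc (((Finset.Icc 1 N).filter (Hits k r h p)).card : ℝ)
      ≤ ∑ i : Fin r, (((Finset.Icc 1 N).filter fun n => p ^ k ∣ n + h i).card : ℝ) := by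
        exact_mod_cast h1
    _ ≤ ∑ _i : Fin r, X / (p : ℝ) ^ k := by
        refine Finset.sum_le_sum fun i _ => ?_
        calc _ ≤ (((N + h i) / p ^ k : ℕ) : ℝ) := by exact_mod_cast card_dvd_add_le _ _ _
          _ ≤ ((N + h i : ℕ) : ℝ) / ((p ^ k : ℕ) : ℝ) := Nat.cast_div_le
          _ ≤ _ := by
            rw [Nat.cast_pow]
            gcongr
            exact hX i
    _ = _ := by simp

end ResidueCount

section DensitySeries

lemma exists_pow_card_primeFactors_le {c : ℝ} (hc : 1 ≤ c) {δ : ℝ} (hδ : 0 < δ) :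
    ∃ C : ℝ, 0 ≤ C ∧ ∀ n : ℕ, n ≠ 0 → c ^ n.primeFactors.card ≤ C * (n : ℝ) ^ δ := by
  set S := Finset.range ⌈c ^ (1 / δ)⌉₊ with hS
  refine ⟨c ^ S.card, by positivity, fun n hn => ?_⟩
  have hlocal : ∀ p ∈ n.primeFactors, c ≤ (if p ∈ S then c else 1) * (p : ℝ) ^ δ := by
    intro p hp
    have hp1 : (1 : ℝ) ≤ p := by exact_mod_cast (Nat.prime_of_mem_primeFactors hp).one_le
    split_ifs with hpS
    · have : (1 : ℝ) ≤ (p : ℝ) ^ δ := Real.one_le_rpow hp1 hδ.le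
      nlinarith
    · rw [hS, Finset.mem_range, not_lt, Nat.ceil_le] at hpS
      rw [one_mul]
      calc c = (c ^ (1 / δ)) ^ δ := by
            rw [← Real.rpow_mul (by linarith), one_div_mul_cancel hδ.ne', Real.rpow_one]
        _ ≤ _ := Real.rpow_le_rpow (by positivity) hpS hδ.le
  calc c ^ n.primeFactors.card = ∏ _p ∈ n.primeFactors, c := by rw [Finset.prod_const]
    _ ≤ ∏ p ∈ n.primeFactors, (if p ∈ S then c else 1) * (p : ℝ) ^ δ :=
        Finset.prod_le_prod (fun _ _ => by linarith) hlocal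
    _ = (∏ p ∈ n.primeFactors, if p ∈ S then c else 1)
          * ((∏ p ∈ n.primeFactors, p : ℕ) : ℝ) ^ δ := by
        rw [Finset.prod_mul_distrib, Nat.cast_prod, Real.finsetProd_rpow _ _ fun _ _ => by positivity]
    _ ≤ c ^ S.card * (n : ℝ) ^ δ := by
        gcongr
        · rw [Finset.prod_ite_mem, Finset.prod_const]
          exact pow_le_pow_right₀ hc (Finset.card_le_card Finset.inter_subset_right)
        · exact Nat.le_of_dvd (Nat.pos_of_ne_zero hn) (Nat.prod_primeFactors_dvd n)

lemma residueCount_le (k r : ℕ) (h : Fin r → ℕ) (D : ℕ) :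
    (residueCount k r h D : ℝ) ≤ (r : ℝ) ^ D.primeFactors.card := by
  unfold residueCount
  rw [Nat.cast_prod, ← Finset.prod_const]
  exact Finset.prod_le_prod (fun _ _ => by positivity) fun p _ => by exact_mod_cast Rp_le k r h p

lemma exists_residueCount_le (k : ℕ) {r : ℕ} (hr : 1 ≤ r) (h : Fin r → ℕ) {δ : ℝ} (hδ : 0 < δ) :
    ∃ C : ℝ, 0 ≤ C ∧ ∀ D : ℕ, D ≠ 0 → (residueCount k r h D : ℝ) ≤ C * (D : ℝ) ^ δ := by
  obtain ⟨C, hC, H⟩ := exists_pow_card_primeFactors_le (c := r) (by exact_mod_cast hr) hδ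
  exact ⟨C, hC, fun D hD => (residueCount_le k r h D).trans (H D hD)⟩

/-- The terms of the density of the `k`-free tuples written as a simple series. -/
def densityTerm (k r : ℕ) (h : Fin r → ℕ) (D : ℕ) : ℝ :=
  (ArithmeticFunction.moebius D : ℝ) * residueCount k r h D / (D : ℝ) ^ k

lemma abs_densityTerm_le (k r : ℕ) (h : Fin r → ℕ) (D : ℕ) :
    |densityTerm k r h D| ≤ residueCount k r h D / (D : ℝ) ^ k := by
  unfold densityTerm
  rw [abs_div, abs_mul, Nat.abs_cast, abs_of_nonneg (by positivity : (0 : ℝ) ≤ (D : ℝ) ^ k)]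
  gcongr
  have h1 : |(ArithmeticFunction.moebius D : ℝ)| ≤ 1 := by
    exact_mod_cast ArithmeticFunction.abs_moebius_le_one
  calc _ ≤ 1 * (residueCount k r h D : ℝ) := by gcongr
    _ = _ := one_mul _

lemma summable_neg_one_sub {δ : ℝ} (hδ : 0 < δ) : Summable fun n : ℕ => (n : ℝ) ^ (-1 - δ) :=
  Real.summable_nat_rpow.2 (by linarith)

lemma sum_rpow_div_pow_le {δ : ℝ} (hδ : 0 < δ) {k : ℕ} (hk : 2 * δ ≤ k - 1) {z : ℝ} (hz : 0 < z)
    {s : Finset ℕ} (hs : ∀ D ∈ s, z < D) :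
    ∑ D ∈ s, (D : ℝ) ^ δ / (D : ℝ) ^ k
      ≤ (∑' n : ℕ, (n : ℝ) ^ (-1 - δ)) * z ^ (-((k : ℝ) - 1 - 2 * δ)) := by
  calc ∑ D ∈ s, (D : ℝ) ^ δ / (D : ℝ) ^ k
      ≤ ∑ D ∈ s, (D : ℝ) ^ (-1 - δ) * z ^ (-((k : ℝ) - 1 - 2 * δ)) := by
        refine Finset.sum_le_sum fun D hD => ?_
        have hDz := hs D hD
        have hD0 : (0 : ℝ) < D := hz.trans hDz
        have e : (D : ℝ) ^ δ / (D : ℝ) ^ k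
            = (D : ℝ) ^ (-1 - δ) * (D : ℝ) ^ (-((k : ℝ) - 1 - 2 * δ)) := by
          rw [← Real.rpow_natCast, ← Real.rpow_sub hD0, ← Real.rpow_add hD0]
          congr 1
          ring
        rw [e]
        exact mul_le_mul_of_nonneg_left
          (Real.rpow_le_rpow_of_nonpos hz hDz.le (by linarith)) (by positivity)
    _ = (∑ D ∈ s, (D : ℝ) ^ (-1 - δ)) * z ^ (-((k : ℝ) - 1 - 2 * δ)) := by
        rw [Finset.sum_mul]
    _ ≤ _ := by
        gcongr
        exact (summable_neg_one_sub hδ).sum_le_tsum _ fun _ _ => by positivity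

lemma sum_residueCount_div_le {k r : ℕ} {h : Fin r → ℕ} {C δ : ℝ} (hδ : 0 < δ) (hC : 0 ≤ C)
    (hres : ∀ D : ℕ, D ≠ 0 → (residueCount k r h D : ℝ) ≤ C * (D : ℝ) ^ δ)
    (hk : 2 * δ ≤ k - 1) {z : ℝ} (hz : 0 < z) {s : Finset ℕ} (hs : ∀ D ∈ s, z < D) :
    ∑ D ∈ s, (residueCount k r h D : ℝ) / (D : ℝ) ^ k
      ≤ C * ((∑' n : ℕ, (n : ℝ) ^ (-1 - δ)) * z ^ (-((k : ℝ) - 1 - 2 * δ))) := by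
  refine le_trans ?_ (mul_le_mul_of_nonneg_left (sum_rpow_div_pow_le hδ hk hz hs) hC)
  rw [Finset.mul_sum]
  refine Finset.sum_le_sum fun D hD => ?_
  have hD0 : D ≠ 0 := by
    rintro rfl
    have := hs 0 hD
    simp only [Nat.cast_zero] at this
    linarith
  rw [← mul_div_assoc]
  gcongr
  exact hres D hD0

lemma summable_densityTerm {k r : ℕ} (hk : 2 ≤ k) (hr : 1 ≤ r) (h : Fin r → ℕ) :
    Summable fun D => |densityTerm k r h D| := by
  obtain ⟨C, hC, hres⟩ := exists_residueCount_le k hr h (δ := 1 / 2) (by norm_num)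
  have hk' : (2 : ℝ) ≤ k := by exact_mod_cast hk
  refine Summable.of_nonneg_of_le (fun _ => abs_nonneg _) (fun D => ?_)
    ((Real.summable_nat_rpow (p := 1 / 2 - k)).2 (by linarith) |>.mul_left C)
  rcases Nat.eq_zero_or_pos D with rfl | hD
  · simp only [densityTerm, ArithmeticFunction.map_zero, Int.cast_zero, zero_mul, zero_div,
      abs_zero]
    positivity
  · refine (abs_densityTerm_le k r h D).trans ?_
    have hD0 : (0 : ℝ) < D := by exact_mod_cast hD
    rw [Real.rpow_sub hD0, Real.rpow_natCast, ← mul_div_assoc]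
    gcongr
    exact hres D hD.ne'

theorem tsum_densityTerm {k r : ℕ} (hk : 2 ≤ k) (hr : 1 ≤ r) (h : Fin r → ℕ) :
    ∑' D, densityTerm k r h D
      = ∏' p : Nat.Primes, (1 - (Rp k r h (p : ℕ) : ℝ) / (p : ℕ) ^ k) := by
  have h1 : densityTerm k r h 1 = 1 := by simp [densityTerm, residueCount]
  rw [← EulerProduct.eulerProduct_tprod h1 _ (summable_densityTerm hk hr h)
    (by simp [densityTerm])]
  · refine tprod_congr fun p => ?_
    rw [tsum_eq_sum (s := Finset.range 2)]
    · rw [Finset.sum_range_succ, Finset.sum_range_one, pow_zero, h1, pow_one, densityTerm,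
        residueCount, p.2.primeFactors, Finset.prod_singleton,
        ArithmeticFunction.moebius_apply_prime p.2]
      push_cast
      ring
    · intro e he
      rw [Finset.mem_range, not_lt] at he
      rw [densityTerm, ArithmeticFunction.moebius_apply_prime_pow p.2 (by omega),
        if_neg (by omega)]
      simp
  · intro m n hmn
    simp only [densityTerm, residueCount,
      ArithmeticFunction.isMultiplicative_moebius.map_mul_of_coprime hmn, hmn.primeFactors_mul,
      Finset.prod_union hmn.disjoint_primeFactors]
    push_cast
    ring

lemma abs_tsum_densityTerm_sub_le {k r : ℕ} (hk2 : 2 ≤ k) (hr : 1 ≤ r) {h : Fin r → ℕ} {C δ : ℝ}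
    (hδ : 0 < δ) (hC : 0 ≤ C)
    (hres : ∀ D : ℕ, D ≠ 0 → (residueCount k r h D : ℝ) ≤ C * (D : ℝ) ^ δ)
    (hk : 2 * δ ≤ k - 1) {y : ℝ} (hy : 0 < y) {s : Finset ℕ}
    (hs : ∀ D ∉ s, densityTerm k r h D ≠ 0 → y < D) :
    |∑' D, densityTerm k r h D - ∑ D ∈ s, densityTerm k r h D|
      ≤ C * ((∑' n : ℕ, (n : ℝ) ^ (-1 - δ)) * y ^ (-((k : ℝ) - 1 - 2 * δ))) := by
  have hlim := (summable_densityTerm hk2 hr h).of_abs.hasSum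
  refine le_of_tendsto ((hlim.sub_const _).abs) ?_
  filter_upwards [Filter.eventually_ge_atTop s] with t ht
  rw [← Finset.sum_sdiff ht, add_sub_cancel_right]
  calc |∑ D ∈ t \ s, densityTerm k r h D|
      = |∑ D ∈ (t \ s).filter (fun D => densityTerm k r h D ≠ 0), densityTerm k r h D| := by
        rw [Finset.sum_filter_ne_zero]
    _ ≤ ∑ D ∈ (t \ s).filter (fun D => densityTerm k r h D ≠ 0), |densityTerm k r h D| :=
        Finset.abs_sum_le_sum_abs _ _
    _ ≤ ∑ D ∈ (t \ s).filter (fun D => densityTerm k r h D ≠ 0),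
          (residueCount k r h D : ℝ) / (D : ℝ) ^ k :=
        Finset.sum_le_sum fun D _ => abs_densityTerm_le k r h D
    _ ≤ _ := by
        refine sum_residueCount_div_le hδ hC hres hk hy fun D hD => ?_
        simp only [Finset.mem_filter, Finset.mem_sdiff] at hD
        exact hs D hD.1.2 hD.2

end DensitySeries

section Sieve

/-- The product of the primes `p` such that `p ^ k ∣ n + h i` for some `i`. -/
def hitRadical (k r : ℕ) (h : Fin r → ℕ) (n : ℕ) : ℕ :=
  ∏ p ∈ (∏ i, (n + h i)).primeFactors.filter (fun p => ∃ i, p ^ k ∣ n + h i), p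

variable {k r : ℕ} {h : Fin r → ℕ} {n : ℕ}

lemma prod_shift_ne_zero (hn : 1 ≤ n) : ∏ i, (n + h i) ≠ 0 :=
  Finset.prod_ne_zero_iff.2 fun _ _ => by omega

lemma primeFactors_hitRadical : (hitRadical k r h n).primeFactors
    = (∏ i, (n + h i)).primeFactors.filter (fun p => ∃ i, p ^ k ∣ n + h i) :=
  Nat.primeFactors_prod fun _ hp => Nat.prime_of_mem_primeFactors (Finset.mem_filter.1 hp).1

lemma mem_primeFactors_hitRadical (hk : 2 ≤ k) (hn : 1 ≤ n) {p : ℕ} :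
    p ∈ (hitRadical k r h n).primeFactors ↔ p.Prime ∧ ∃ i, p ^ k ∣ n + h i := by
  rw [primeFactors_hitRadical, Finset.mem_filter, Nat.mem_primeFactors]
  refine ⟨fun H => ⟨H.1.1, H.2⟩, fun H => ⟨⟨H.1, ?_, prod_shift_ne_zero hn⟩, H.2⟩⟩
  obtain ⟨i, hi⟩ := H.2
  exact ((dvd_pow_self p (by omega)).trans hi).trans (Finset.dvd_prod_of_mem _ (Finset.mem_univ i))

lemma hitRadical_ne_zero : hitRadical k r h n ≠ 0 :=
  Finset.prod_ne_zero_iff.2 fun _ hp =>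
    (Nat.prime_of_mem_primeFactors (Finset.mem_filter.1 hp).1).ne_zero

lemma squarefree_hitRadical : Squarefree (hitRadical k r h n) := by
  unfold hitRadical
  refine Finset.squarefree_prod_of_pairwise_isCoprime (fun p hp q hq hpq => ?_) fun p hp => ?_
  · exact Nat.coprime_iff_isRelPrime.1 ((Nat.coprime_primes
      (Nat.prime_of_mem_primeFactors (Finset.mem_filter.1 hp).1)
      (Nat.prime_of_mem_primeFactors (Finset.mem_filter.1 hq).1)).2 hpq)
  · exact (Nat.prime_of_mem_primeFactors (Finset.mem_filter.1 hp).1).prime.squarefree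

lemma hitRadical_le (hn : 1 ≤ n) : hitRadical k r h n ≤ ∏ i, (n + h i) :=
  Nat.le_of_dvd (Nat.pos_of_ne_zero (prod_shift_ne_zero hn))
    ((Finset.prod_dvd_prod_of_subset _ _ _ (Finset.filter_subset _ _)).trans
      (Nat.prod_primeFactors_dvd _))

lemma dvd_hitRadical_iff (hk : 2 ≤ k) (hn : 1 ≤ n) {D : ℕ} :
    D ∣ hitRadical k r h n ↔ Squarefree D ∧ Hits k r h D n := by
  constructor
  · intro H
    exact ⟨squarefree_hitRadical.squarefree_of_dvd H, fun p hp =>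
      ((mem_primeFactors_hitRadical hk hn).1
        (Nat.primeFactors_mono H hitRadical_ne_zero hp)).2⟩
  · rintro ⟨hD, H⟩
    rw [← Nat.prod_primeFactors_of_squarefree hD,
      ← Nat.prod_primeFactors_of_squarefree (squarefree_hitRadical (k := k) (h := h) (n := n))]
    refine Finset.prod_dvd_prod_of_subset _ _ _ fun p hp => ?_
    exact (mem_primeFactors_hitRadical hk hn).2 ⟨Nat.prime_of_mem_primeFactors hp, H p hp⟩

lemma forall_kFree_iff (hk : 2 ≤ k) (hn : 1 ≤ n) :
    (∀ i, KFree k (n + h i)) ↔ hitRadical k r h n = 1 := by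
  constructor
  · intro H
    rw [Nat.eq_one_iff_not_exists_prime_dvd]
    intro p hp hdvd
    obtain ⟨-, i, hi⟩ := (mem_primeFactors_hitRadical hk hn).1
      (Nat.mem_primeFactors.2 ⟨hp, hdvd, hitRadical_ne_zero⟩)
    exact H i p hp hi
  · intro H i p hp hi
    have := (mem_primeFactors_hitRadical (h := h) hk hn).2 ⟨hp, i, hi⟩
    rw [H] at this
    simp at this

lemma sum_divisors_moebius (m : ℕ) :
    ∑ d ∈ m.divisors, ArithmeticFunction.moebius d = if m = 1 then 1 else 0 := by
  rw [← ArithmeticFunction.coe_mul_zeta_apply, ArithmeticFunction.moebius_mul_coe_zeta,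
    ArithmeticFunction.one_apply]

lemma card_divisors_of_squarefree {m : ℕ} (hm : Squarefree m) :
    m.divisors.card = 2 ^ m.primeFactors.card := by
  rw [Nat.card_divisors hm.ne_zero, ← Finset.prod_const]
  refine Finset.prod_congr rfl fun p hp => ?_
  rw [Nat.mem_primeFactors] at hp
  rw [Nat.factorization_eq_one_of_squarefree hm hp.1 hp.2.1]

/-- The truncated Möbius sum detects `k`-free tuples unless `hitRadical` is large. -/
lemma abs_indicator_sub_sum_le (hk : 2 ≤ k) (hn : 1 ≤ n) {y : ℝ} (hy : 1 ≤ y) :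
    |(if ∀ i, KFree k (n + h i) then (1 : ℝ) else 0)
        - ∑ D ∈ (Finset.Icc 1 ⌊y⌋₊).filter Squarefree,
            if Hits k r h D n then (ArithmeticFunction.moebius D : ℝ) else 0|
      ≤ if y < hitRadical k r h n then (2 : ℝ) ^ (hitRadical k r h n).primeFactors.card else 0 := by
  set F := hitRadical k r h n with hF
  have hy0 : (0 : ℝ) ≤ y := by linarith
  have hset : ((Finset.Icc 1 ⌊y⌋₊).filter Squarefree).filter (fun D => Hits k r h D n)
      = F.divisors.filter fun D : ℕ => (D : ℝ) ≤ y := by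
    ext D
    simp only [Finset.mem_filter, Finset.mem_Icc, Nat.mem_divisors, hF, dvd_hitRadical_iff hk hn,
      Nat.le_floor_iff hy0]
    constructor
    · rintro ⟨⟨⟨_, h2⟩, h3⟩, h4⟩
      exact ⟨⟨⟨h3, h4⟩, hitRadical_ne_zero⟩, h2⟩
    · rintro ⟨⟨⟨h3, h4⟩, -⟩, h2⟩
      exact ⟨⟨⟨Nat.pos_of_ne_zero h3.ne_zero, h2⟩, h3⟩, h4⟩
  rw [← Finset.sum_filter, hset]
  simp only [forall_kFree_iff hk hn, ← hF]
  split_ifs with h1 h2 h2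
  · rw [h1] at h2
    norm_num at h2
    linarith
  · rw [h1]
    simp [Finset.filter_singleton, hy]
  · rw [zero_sub, abs_neg]
    calc _ ≤ ∑ D ∈ F.divisors.filter fun D : ℕ => (D : ℝ) ≤ y,
          |(ArithmeticFunction.moebius D : ℝ)| := Finset.abs_sum_le_sum_abs _ _
      _ ≤ ∑ D ∈ F.divisors.filter fun D : ℕ => (D : ℝ) ≤ y, (1 : ℝ) :=
          Finset.sum_le_sum fun D _ => by exact_mod_cast ArithmeticFunction.abs_moebius_le_one
      _ ≤ ∑ D ∈ F.divisors, (1 : ℝ) :=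
          Finset.sum_le_sum_of_subset_of_nonneg (Finset.filter_subset _ _) fun _ _ _ => zero_le_one
      _ = _ := by
          rw [Finset.sum_const, nsmul_eq_mul, mul_one,
            card_divisors_of_squarefree squarefree_hitRadical]
          push_cast
          rfl
  · rw [not_lt] at h2
    rw [Finset.filter_true_of_mem fun D hD => ?_]
    · have := sum_divisors_moebius F
      rw [if_neg h1] at this
      rw [← Int.cast_sum, this]
      simp
    · refine le_trans ?_ h2
      exact_mod_cast Nat.divisor_le hD

/-- A number above `z` without prime factors above `z` has a divisor in `(z, z ^ 2]`. -/
lemma exists_dvd_mem_Ioc {z : ℝ} (hz : 1 ≤ z) (F : ℕ) (hF : z < F)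
    (hp : ∀ p : ℕ, p.Prime → p ∣ F → (p : ℝ) ≤ z) :
    ∃ D : ℕ, D ∣ F ∧ z < D ∧ (D : ℝ) ≤ z ^ 2 := by
  induction F using Nat.strong_induction_on with
  | _ F ih =>
    by_cases hle : (F : ℝ) ≤ z ^ 2
    · exact ⟨F, dvd_rfl, hF, hle⟩
    · rw [not_le] at hle
      have hF1 : F ≠ 1 := by
        rintro rfl
        norm_num at hF
        linarith
      obtain ⟨p, hpp, m, rfl⟩ := Nat.exists_prime_and_dvd hF1
      have hpz := hp p hpp (dvd_mul_right p m)
      have hm0 : 0 < m := by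
        rcases Nat.eq_zero_or_pos m with rfl | hm
        · norm_num at hF
          linarith
        · exact hm
      have hzm : z < m := by
        push_cast at hle
        have hm0' : (0 : ℝ) < m := by exact_mod_cast hm0
        nlinarith
      obtain ⟨D, hD, h1, h2⟩ := ih m
        (by nlinarith [hpp.two_le]) hzm fun q hq hqm => hp q hq (hqm.mul_left p)
      exact ⟨D, hD.mul_left p, h1, h2⟩

end Sieve

section Counting

variable {k r : ℕ} {h : Fin r → ℕ}

lemma sum_residueCount_le {C δ : ℝ} (hδ : 0 < δ) (hC : 0 ≤ C)
    (hres : ∀ D : ℕ, D ≠ 0 → (residueCount k r h D : ℝ) ≤ C * (D : ℝ) ^ δ)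
    {y : ℝ} (hy : 0 < y) :
    ∑ D ∈ (Finset.Icc 1 ⌊y⌋₊).filter Squarefree, (residueCount k r h D : ℝ)
      ≤ C * y ^ (1 + δ) := by
  calc _ ≤ ∑ D ∈ (Finset.Icc 1 ⌊y⌋₊).filter Squarefree, C * y ^ δ := by
        refine Finset.sum_le_sum fun D hD => (hres D (Finset.mem_filter.1 hD).2.ne_zero).trans ?_
        simp only [Finset.mem_filter, Finset.mem_Icc, Nat.le_floor_iff hy.le] at hD
        have := hD.1.2
        gcongr
    _ ≤ y * (C * y ^ δ) := by
        rw [Finset.sum_const, nsmul_eq_mul]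
        gcongr
        calc (((Finset.Icc 1 ⌊y⌋₊).filter Squarefree).card : ℝ) ≤ (⌊y⌋₊ : ℝ) := by
              exact_mod_cast (Finset.card_filter_le _ _).trans (by simp)
          _ ≤ y := Nat.floor_le hy.le
    _ = _ := by rw [Real.rpow_add hy, Real.rpow_one]; ring

lemma card_large_hitRadical_le (hk2 : 2 ≤ k) {C δ : ℝ} (hδ : 0 < δ) (hC : 0 ≤ C)
    (hres : ∀ D : ℕ, D ≠ 0 → (residueCount k r h D : ℝ) ≤ C * (D : ℝ) ^ δ)
    (hk : 2 * δ ≤ k - 1) {x z X : ℝ} (hx : 0 ≤ x) (hz : 1 ≤ z)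
    (hX : ∀ i, ((⌊x⌋₊ + h i : ℕ) : ℝ) ≤ X) (hX0 : 0 ≤ X) :
    (((Finset.Icc 1 ⌊x⌋₊).filter fun n => z ^ 2 < hitRadical k r h n).card : ℝ)
      ≤ x * (C * ((∑' n : ℕ, (n : ℝ) ^ (-1 - δ)) * z ^ (-((k : ℝ) - 1 - 2 * δ))))
        + 2 * (C * (z ^ 2) ^ (1 + δ))
        + r * X * ((∑' n : ℕ, (n : ℝ) ^ (-1 - δ)) * z ^ (-((k : ℝ) - 1 - 2 * δ))) := by
  have hz0 : 0 < z := by linarith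
  set S : Finset ℕ := (Finset.Icc 1 ⌊z ^ 2⌋₊).filter Squarefree with hS
  set S₁ : Finset ℕ := S.filter (fun D => z < (D : ℝ)) with hS₁
  set S₂ : Finset ℕ := (Finset.range (⌊X⌋₊ + 1)).filter (fun p => p.Prime ∧ z < (p : ℝ)) with hS₂
  have hsub : ((Finset.Icc 1 ⌊x⌋₊).filter fun n => z ^ 2 < hitRadical k r h n) ⊆
      (S₁.biUnion fun D => (Finset.Icc 1 ⌊x⌋₊).filter (Hits k r h D)) ∪
        (S₂.biUnion fun p => (Finset.Icc 1 ⌊x⌋₊).filter (Hits k r h p)) := by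
    intro n hn
    obtain ⟨hnI, hnF⟩ := Finset.mem_filter.1 hn
    have hn1 : 1 ≤ n := (Finset.mem_Icc.1 hnI).1
    rw [Finset.mem_union]
    by_cases hlarge : ∃ p : ℕ, p.Prime ∧ p ∣ hitRadical k r h n ∧ z < p
    · obtain ⟨p, hp, hpF, hzp⟩ := hlarge
      right
      refine Finset.mem_biUnion.2 ⟨p, ?_, Finset.mem_filter.2
        ⟨hnI, ((dvd_hitRadical_iff hk2 hn1).1 hpF).2⟩⟩
      refine Finset.mem_filter.2 ⟨?_, hp, hzp⟩
      obtain ⟨-, i, hi⟩ := (mem_primeFactors_hitRadical hk2 hn1).1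
        (Nat.mem_primeFactors.2 ⟨hp, hpF, hitRadical_ne_zero⟩)
      rw [Finset.mem_range, Nat.lt_succ_iff, Nat.le_floor_iff hX0]
      refine le_trans ?_ (hX i)
      have h1 : p ≤ n + h i := (Nat.le_self_pow (by omega) p).trans (Nat.le_of_dvd (by omega) hi)
      have h2 := (Finset.mem_Icc.1 hnI).2
      exact_mod_cast h1.trans (by omega)
    · push Not at hlarge
      have hzF : z < hitRadical k r h n := by nlinarith
      obtain ⟨D, hDF, hzD, hDy⟩ := exists_dvd_mem_Ioc hz _ hzF hlarge
      have hD := (dvd_hitRadical_iff hk2 hn1).1 hDF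
      left
      refine Finset.mem_biUnion.2 ⟨D, ?_, Finset.mem_filter.2 ⟨hnI, hD.2⟩⟩
      simp only [hS₁, hS, Finset.mem_filter, Finset.mem_Icc, Nat.le_floor_iff (sq_nonneg z)]
      exact ⟨⟨⟨Nat.pos_of_ne_zero hD.1.ne_zero, hDy⟩, hD.1⟩, hzD⟩
  have hcard : (((Finset.Icc 1 ⌊x⌋₊).filter fun n => z ^ 2 < hitRadical k r h n).card : ℝ)
      ≤ ∑ D ∈ S₁, (((Finset.Icc 1 ⌊x⌋₊).filter (Hits k r h D)).card : ℝ)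
        + ∑ p ∈ S₂, (((Finset.Icc 1 ⌊x⌋₊).filter (Hits k r h p)).card : ℝ) := by
    have := (Finset.card_le_card hsub).trans ((Finset.card_union_le _ _).trans
      (Nat.add_le_add Finset.card_biUnion_le Finset.card_biUnion_le))
    exact_mod_cast this
  have h1 : ∑ D ∈ S₁, (((Finset.Icc 1 ⌊x⌋₊).filter (Hits k r h D)).card : ℝ)
      ≤ x * (∑ D ∈ S₁, (residueCount k r h D : ℝ) / (D : ℝ) ^ k)
        + 2 * ∑ D ∈ S, (residueCount k r h D : ℝ) := by
    calc _ ≤ ∑ D ∈ S₁, (x * ((residueCount k r h D : ℝ) / (D : ℝ) ^ k)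
            + 2 * (residueCount k r h D : ℝ)) := by
          refine Finset.sum_le_sum fun D hD => ?_
          have hsq : Squarefree D := (Finset.mem_filter.1 (Finset.mem_filter.1 hD).1).2
          have h2 := (abs_le.1 (abs_card_hits_sub_le (k := k) (h := h) hsq hx)).2
          have e : (residueCount k r h D : ℝ) * x / (D : ℝ) ^ k
            = x * ((residueCount k r h D : ℝ) / (D : ℝ) ^ k) := by ring
          linarith
      _ = x * (∑ D ∈ S₁, (residueCount k r h D : ℝ) / (D : ℝ) ^ k)
            + 2 * ∑ D ∈ S₁, (residueCount k r h D : ℝ) := by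
          rw [Finset.sum_add_distrib, Finset.mul_sum, Finset.mul_sum]
      _ ≤ _ := by
          gcongr
          exact Finset.filter_subset _ _
  have h2 : ∑ p ∈ S₂, (((Finset.Icc 1 ⌊x⌋₊).filter (Hits k r h p)).card : ℝ)
      ≤ r * X * ∑ p ∈ S₂, (p : ℝ) ^ δ / (p : ℝ) ^ k := by
    rw [Finset.mul_sum]
    refine Finset.sum_le_sum fun p hp => ?_
    have hp' := (Finset.mem_filter.1 hp).2
    refine (card_hits_prime_le hp'.1 hX).trans ?_
    have h3 : (1 : ℝ) ≤ (p : ℝ) ^ δ :=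
      Real.one_le_rpow (by exact_mod_cast hp'.1.one_le) hδ.le
    calc (r : ℝ) * (X / (p : ℝ) ^ k) = r * X * (1 / (p : ℝ) ^ k) := by ring
      _ ≤ _ := by gcongr
  have h3 := sum_residueCount_div_le hδ hC hres hk hz0 (s := S₁)
    fun D hD => (Finset.mem_filter.1 hD).2
  have h4 := sum_rpow_div_pow_le hδ hk hz0 (s := S₂) fun p hp => (Finset.mem_filter.1 hp).2.2
  have h5 := sum_residueCount_le hδ hC hres (pow_pos hz0 2)
  have h6 := mul_le_mul_of_nonneg_left h3 hx
  have h7 := mul_le_mul_of_nonneg_left h4 (mul_nonneg r.cast_nonneg hX0)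
  linarith

lemma abs_countR_sub_sum_le (hk2 : 2 ≤ k) {C₁ δ : ℝ} (hδ : 0 < δ) (hC₁ : 0 ≤ C₁)
    (hdiv : ∀ n : ℕ, n ≠ 0 → (2 : ℝ) ^ n.primeFactors.card ≤ C₁ * (n : ℝ) ^ δ)
    {x y X : ℝ} (hy : 1 ≤ y) (hX : ∀ i, ((⌊x⌋₊ + h i : ℕ) : ℝ) ≤ X) :
    |(countR k r h x 1 0 : ℝ) - ∑ D ∈ (Finset.Icc 1 ⌊y⌋₊).filter Squarefree,
        (ArithmeticFunction.moebius D : ℝ)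
          * (((Finset.Icc 1 ⌊x⌋₊).filter (Hits k r h D)).card : ℝ)|
      ≤ C₁ * (X ^ r) ^ δ
        * (((Finset.Icc 1 ⌊x⌋₊).filter fun n => y < hitRadical k r h n).card : ℝ) := by
  have hcount : (countR k r h x 1 0 : ℝ)
      = ∑ n ∈ Finset.Icc 1 ⌊x⌋₊, if ∀ i, KFree k (n + h i) then (1 : ℝ) else 0 := by
    rw [Finset.sum_boole, countR]
    simp only [Nat.mod_one, and_true]
  have hsum : ∑ D ∈ (Finset.Icc 1 ⌊y⌋₊).filter Squarefree,
        (ArithmeticFunction.moebius D : ℝ)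
          * (((Finset.Icc 1 ⌊x⌋₊).filter (Hits k r h D)).card : ℝ)
      = ∑ n ∈ Finset.Icc 1 ⌊x⌋₊, ∑ D ∈ (Finset.Icc 1 ⌊y⌋₊).filter Squarefree,
          if Hits k r h D n then (ArithmeticFunction.moebius D : ℝ) else 0 := by
    rw [Finset.sum_comm]
    refine Finset.sum_congr rfl fun D _ => ?_
    rw [← Finset.sum_filter, Finset.sum_const, nsmul_eq_mul, mul_comm]
  rw [hcount, hsum, ← Finset.sum_sub_distrib]
  calc _ ≤ ∑ n ∈ Finset.Icc 1 ⌊x⌋₊, |_| := Finset.abs_sum_le_sum_abs _ _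
    _ ≤ ∑ n ∈ Finset.Icc 1 ⌊x⌋₊, if y < hitRadical k r h n then
          (2 : ℝ) ^ (hitRadical k r h n).primeFactors.card else 0 :=
        Finset.sum_le_sum fun n hn => abs_indicator_sub_sum_le hk2 (Finset.mem_Icc.1 hn).1 hy
    _ = ∑ n ∈ (Finset.Icc 1 ⌊x⌋₊).filter (fun n => y < hitRadical k r h n),
          (2 : ℝ) ^ (hitRadical k r h n).primeFactors.card := (Finset.sum_filter _ _).symm
    _ ≤ ∑ n ∈ (Finset.Icc 1 ⌊x⌋₊).filter (fun n => y < hitRadical k r h n),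
          C₁ * (X ^ r) ^ δ := by
        refine Finset.sum_le_sum fun n hn => (hdiv _ hitRadical_ne_zero).trans ?_
        have hnI := Finset.mem_Icc.1 (Finset.mem_filter.1 hn).1
        gcongr
        calc (hitRadical k r h n : ℝ) ≤ ((∏ i, (n + h i) : ℕ) : ℝ) := by
              exact_mod_cast hitRadical_le hnI.1
          _ = ∏ i, ((n + h i : ℕ) : ℝ) := Nat.cast_prod _ _
          _ ≤ ∏ _i : Fin r, X := by
              refine Finset.prod_le_prod (fun _ _ => by positivity) fun i _ => le_trans ?_ (hX i)
              exact_mod_cast Nat.add_le_add_right hnI.2 _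
          _ = X ^ r := by simp
    _ = _ := by rw [Finset.sum_const, nsmul_eq_mul, mul_comm]

lemma abs_sum_card_hits_sub_le {C δ : ℝ} (hδ : 0 < δ) (hC : 0 ≤ C)
    (hres : ∀ D : ℕ, D ≠ 0 → (residueCount k r h D : ℝ) ≤ C * (D : ℝ) ^ δ)
    {x y : ℝ} (hx : 0 ≤ x) (hy : 0 < y) :
    |∑ D ∈ (Finset.Icc 1 ⌊y⌋₊).filter Squarefree, (ArithmeticFunction.moebius D : ℝ)
          * (((Finset.Icc 1 ⌊x⌋₊).filter (Hits k r h D)).card : ℝ)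
        - (∑ D ∈ (Finset.Icc 1 ⌊y⌋₊).filter Squarefree, densityTerm k r h D) * x|
      ≤ 2 * (C * y ^ (1 + δ)) := by
  rw [Finset.sum_mul, ← Finset.sum_sub_distrib]
  calc _ ≤ ∑ D ∈ (Finset.Icc 1 ⌊y⌋₊).filter Squarefree, |_| := Finset.abs_sum_le_sum_abs _ _
    _ ≤ ∑ D ∈ (Finset.Icc 1 ⌊y⌋₊).filter Squarefree, 2 * (residueCount k r h D : ℝ) := by
        refine Finset.sum_le_sum fun D hD => ?_
        have h1 := abs_card_hits_sub_le (k := k) (h := h) (Finset.mem_filter.1 hD).2 hx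
        have h2 : |(ArithmeticFunction.moebius D : ℝ)| ≤ 1 := by
          exact_mod_cast ArithmeticFunction.abs_moebius_le_one
        have e : (ArithmeticFunction.moebius D : ℝ)
              * (((Finset.Icc 1 ⌊x⌋₊).filter (Hits k r h D)).card : ℝ) - densityTerm k r h D * x
            = (ArithmeticFunction.moebius D : ℝ)
              * ((((Finset.Icc 1 ⌊x⌋₊).filter (Hits k r h D)).card : ℝ)
                - residueCount k r h D * x / (D : ℝ) ^ k) := by
          rw [densityTerm]; ring
        rw [e, abs_mul]
        calc _ ≤ 1 * (2 * (residueCount k r h D : ℝ)) := by gcongr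
          _ = _ := one_mul _
    _ ≤ _ := by
        rw [← Finset.mul_sum]
        gcongr
        exact sum_residueCount_le hδ hC hres hy

/-- The number of `k`-free tuples up to `x`, with the optimal truncation of the sieve. -/
theorem exists_abs_countR_sub_le (hk2 : 2 ≤ k) (hr : 1 ≤ r) (h : Fin r → ℕ) {ε : ℝ}
    (hε : 0 < ε) :
    ∃ C : ℝ, ∀ x : ℝ, 1 ≤ x →
      |(countR k r h x 1 0 : ℝ) - (∑' D, densityTerm k r h D) * x|
        ≤ C * x ^ (2 / ((k : ℝ) + 1) + ε) := by
  have hkR : (2 : ℝ) ≤ k := by exact_mod_cast hk2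
  obtain ⟨δ, hδ, hδ1, hδε⟩ : ∃ δ : ℝ, 0 < δ ∧ δ ≤ 1 / 2 ∧ (r + 2) * δ ≤ ε := by
    refine ⟨min (1 / 2) (ε / (r + 2)), by positivity, min_le_left _ _, ?_⟩
    calc ((r : ℝ) + 2) * min (1 / 2) (ε / (r + 2)) ≤ (r + 2) * (ε / (r + 2)) := by
          gcongr
          exact min_le_right _ _
      _ = ε := by field_simp
  obtain ⟨C, hC, hres⟩ := exists_residueCount_le k hr h hδ
  obtain ⟨C₁, hC₁, hdiv⟩ := exists_pow_card_primeFactors_le (c := 2) (by norm_num) hδ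
  set Z : ℝ := ∑' n : ℕ, (n : ℝ) ^ (-1 - δ) with hZ
  have hZ0 : 0 ≤ Z := tsum_nonneg fun _ => by positivity
  set K : ℝ := 1 + ∑ i, (h i : ℝ) with hK
  have hK1 : 1 ≤ K := by
    have : (0 : ℝ) ≤ ∑ i, (h i : ℝ) := by positivity
    linarith
  have hkδ : 2 * δ ≤ k - 1 := by linarith
  refine ⟨C₁ * (K ^ r) ^ δ * (C * Z + 2 * C + r * K * Z) + 2 * C + C * Z, fun x hx => ?_⟩
  have hx0 : 0 < x := by linarith
  set z : ℝ := x ^ (1 / ((k : ℝ) + 1)) with hz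
  have hz1 : 1 ≤ z := Real.one_le_rpow hx (by positivity)
  have hz0 : 0 < z := by linarith
  have hy1 : 1 ≤ z ^ 2 := one_le_pow₀ hz1
  set T : ℝ := z ^ (-((k : ℝ) - 1 - 2 * δ)) with hT
  set W : ℝ := (z ^ 2) ^ (1 + δ) with hW
  have hWz : W = z ^ (2 + 2 * δ) := by
    rw [hW, ← Real.rpow_natCast, ← Real.rpow_mul hz0.le]
    congr 1
    push_cast
    ring
  have hxT : x * T = W := by
    have e : x = z ^ ((k : ℝ) + 1) := by
      rw [hz, ← Real.rpow_mul hx0.le, one_div_mul_cancel (by positivity), Real.rpow_one]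
    rw [hWz, hT]
    nth_rewrite 1 [e]
    rw [← Real.rpow_add hz0]
    congr 1
    ring
  have hW0 : 0 ≤ W := by positivity
  have hWx : W * (x ^ r) ^ δ ≤ x ^ (2 / ((k : ℝ) + 1) + ε) := by
    rw [hWz, hz, ← Real.rpow_mul hx0.le, ← Real.rpow_natCast, ← Real.rpow_mul hx0.le,
      ← Real.rpow_add hx0]
    refine Real.rpow_le_rpow_of_exponent_le hx ?_
    have e : 1 / ((k : ℝ) + 1) * (2 + 2 * δ) = 2 / ((k : ℝ) + 1) + 2 * (δ / ((k : ℝ) + 1)) := by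
      ring
    have e2 : δ / ((k : ℝ) + 1) ≤ δ := div_le_self hδ.le (by linarith)
    rw [e]
    linarith
  have hone : 1 ≤ (x ^ r) ^ δ := Real.one_le_rpow (one_le_pow₀ hx) hδ.le
  have hX : ∀ i, ((⌊x⌋₊ + h i : ℕ) : ℝ) ≤ K * x := by
    intro i
    have h1 : (h i : ℝ) ≤ ∑ i, (h i : ℝ) :=
      Finset.single_le_sum (f := fun i => (h i : ℝ)) (fun _ _ => by positivity) (Finset.mem_univ i)
    have h2 := Nat.floor_le hx0.le
    push_cast
    rw [hK]
    nlinarith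
  have hB := card_large_hitRadical_le hk2 hδ hC hres hkδ hx0.le hz1 hX (by positivity)
  have e₁ := abs_countR_sub_sum_le hk2 hδ hC₁ hdiv hy1 hX
  have e₂ := abs_sum_card_hits_sub_le hδ hC hres hx0.le (pow_pos hz0 2)
  have e₃ := abs_tsum_densityTerm_sub_le hk2 hr hδ hC hres hkδ (pow_pos hz0 2)
    (s := (Finset.Icc 1 ⌊z ^ 2⌋₊).filter Squarefree) fun D hD hne => by
      by_contra hDy
      refine hD (Finset.mem_filter.2 ?_)
      have hsq : Squarefree D := by
        by_contra hsq
        refine hne ?_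
        rw [densityTerm, ArithmeticFunction.moebius_eq_zero_of_not_squarefree hsq]
        simp
      exact ⟨Finset.mem_Icc.2 ⟨Nat.pos_of_ne_zero hsq.ne_zero,
        (Nat.le_floor_iff (by positivity)).2 (not_lt.1 hDy)⟩, hsq⟩
  rw [← hZ] at hB e₃
  rw [← hT, ← hW] at hB
  rw [← hW] at e₂
  have hB' : (((Finset.Icc 1 ⌊x⌋₊).filter fun n => z ^ 2 < hitRadical k r h n).card : ℝ)
      ≤ (C * Z + 2 * C + r * K * Z) * W := by
    refine hB.trans (le_of_eq ?_)
    linear_combination (C * Z + r * K * Z) * hxT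
  have hyT : (z ^ 2) ^ (-((k : ℝ) - 1 - 2 * δ)) ≤ T :=
    Real.rpow_le_rpow_of_nonpos hz0 (by nlinarith) (by linarith)
  have e₃' : |(∑ D ∈ (Finset.Icc 1 ⌊z ^ 2⌋₊).filter Squarefree, densityTerm k r h D) * x
      - (∑' D, densityTerm k r h D) * x| ≤ C * Z * W := by
    rw [← sub_mul, abs_mul, abs_of_pos hx0, abs_sub_comm]
    calc _ ≤ C * (Z * T) * x := by
          gcongr
          exact e₃.trans (by gcongr)
      _ = C * Z * W := by rw [← hxT]; ring
  have e₁' := e₁.trans (mul_le_mul_of_nonneg_left hB' (by positivity))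
  have hKx : ((K * x) ^ r) ^ δ = (K ^ r) ^ δ * (x ^ r) ^ δ := by
    rw [mul_pow, Real.mul_rpow (by positivity) (by positivity)]
  rw [hKx] at e₁'
  have htri := (abs_sub_le (countR k r h x 1 0 : ℝ) _ _).trans
    (add_le_add e₁' ((abs_sub_le _ _ _).trans (add_le_add e₂ e₃')))
  refine htri.trans ?_
  set L : ℝ := C₁ * (K ^ r) ^ δ * (C * Z + 2 * C + r * K * Z) with hL
  have hL0 : 0 ≤ L := by positivity
  have hWle : W ≤ W * (x ^ r) ^ δ := le_mul_of_one_le_right hW0 hone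
  calc _ = L * (W * (x ^ r) ^ δ) + (2 * C + C * Z) * W := by rw [hL]; ring
    _ ≤ L * (W * (x ^ r) ^ δ) + (2 * C + C * Z) * (W * (x ^ r) ^ δ) := by gcongr
    _ = (L + 2 * C + C * Z) * (W * (x ^ r) ^ δ) := by ring
    _ ≤ _ := by gcongr

end Counting

/-- the Euler product identity for the density `ρ` of the `k`-free `r`-tuples,
and the asymptotic count `#{n ≤ x : n ∈ ℛ} = ρ·x + O(x^{2/(k+1)+ε})`. -/
theorem stmt_9 (k r : ℕ) (hk : 2 ≤ k) (hr : 1 ≤ r) (h : Fin r → ℕ) (hh : StrictMono h) :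
    (∑' d : Fin r → ℕ,
        if (∀ i, 1 ≤ d i) ∧
            (∀ i j, ((Nat.gcd (d i ^ k) (d j ^ k) : ℤ) ∣ (h i : ℤ) - (h j : ℤ)))
        then (∏ i, (ArithmeticFunction.moebius (d i) : ℝ)) /
              (((Finset.univ.lcm fun i => d i ^ k) : ℕ) : ℝ)
        else 0)
      = (∏' p : Nat.Primes, (1 - (Rp k r h (p : ℕ) : ℝ) / (p : ℕ) ^ k)) ∧
    ∀ ε : ℝ, 0 < ε → ∃ C : ℝ, ∀ x : ℝ, 1 ≤ x →
      |(countR k r h x 1 0 : ℝ)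
          - (∏' p : Nat.Primes, (1 - (Rp k r h (p : ℕ) : ℝ) / (p : ℕ) ^ k)) * x|
        ≤ C * x ^ (2/((k:ℝ)+1) + ε) := by
  refine ⟨tsum_tupleTerm hk r h, fun ε hε => ?_⟩
  rw [← tsum_densityTerm hk hr h]
  exact exists_abs_countR_sub_le hk hr h hε
end
end
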